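/- arXiv:1705.04767 — 2 statements merged into one kernel-verified Lean document; each statement's English description precedes it below -/
import Mathlib

section
/- Let X be a separable metric space equipped with its Borel σ-algebra, let μ and ν be Radon measures on X (Borel measures that are finite on compact sets), let r > 0, and let A ⊆ X be a Borel subset. Then ∫_A μ(B(x,r)) dν(x) ≤ ∫_{B(A,r)} ν(B(x,r)) dμ(x), where both integrals are Lebesgue integrals of the (extended-nonnegative-real-valued) functions x ↦ μ(B(x,r)) and x ↦ ν(B(x,r)). -/
open MeasureTheory Metric

/-- Let `X` be a separable metric space with its Borel σ-algebra, let `μ` and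
`ν` be Radon measures on `X` (Borel measures that are finite on compact sets; they are moreover
σ-finite), let `r > 0`, and let `A ⊆ X` be a Borel set.  Then
`∫_A μ(B(x,r)) dν(x) ≤ ∫_{B(A,r)} ν(B(x,r)) dμ(x)`, where `B(A,r) = ⋃_{a ∈ A} B(a,r)`. -/
theorem stmt_0 {X : Type*} [MetricSpace X] [TopologicalSpace.SeparableSpace X]
    [MeasurableSpace X] [BorelSpace X]
    (μ ν : Measure X) [IsFiniteMeasureOnCompacts μ] [IsFiniteMeasureOnCompacts ν]
    [SigmaFinite μ] [SigmaFinite ν]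
    (r : ℝ) (hr : 0 < r) (A : Set X) (hA : MeasurableSet A) :
    ∫⁻ x in A, μ (ball x r) ∂ν ≤ ∫⁻ x in ⋃ a ∈ A, ball a r, ν (ball x r) ∂μ := by
  have : SecondCountableTopology X := UniformSpace.secondCountable_of_separable X
  have hS : MeasurableSet {p : X × X | dist p.1 p.2 < r} :=
    measurableSet_lt measurable_dist measurable_const
  calc ∫⁻ x in A, μ (ball x r) ∂ν
      = ((ν.restrict A).prod μ) {p : X × X | dist p.1 p.2 < r} := by
        simp_rw [Measure.prod_apply hS, ball, dist_comm, Set.preimage_ofPred_eq]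
    _ = ∫⁻ y, ν.restrict A (ball y r) ∂μ := by
        simp_rw [Measure.prod_apply_symm hS, ball, Set.preimage_ofPred_eq]
    _ ≤ ∫⁻ y, (⋃ a ∈ A, ball a r).indicator (fun y => ν (ball y r)) y ∂μ := by
        refine lintegral_mono fun y => ?_
        by_cases hy : y ∈ ⋃ a ∈ A, ball a r
        · rw [Set.indicator_of_mem hy]
          exact Measure.restrict_apply_le A _
        · have hdisj : ball y r ∩ A = ∅ := by
            refine Set.eq_empty_of_forall_notMem fun a ha => hy ?_
            exact Set.mem_biUnion ha.2 (mem_ball_comm.1 ha.1)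
          rw [Measure.restrict_apply measurableSet_ball, hdisj, measure_empty]
          exact zero_le
    _ = ∫⁻ x in ⋃ a ∈ A, ball a r, ν (ball x r) ∂μ :=
        lintegral_indicator (isOpen_biUnion fun _ _ => isOpen_ball).measurableSet _
end

section
/- For every n ≥ 1 there exists a constant C > 1 depending only on n with the following property. Let U ⊆ ℝⁿ be an open set and let g = (g_{ij}) be a smooth Riemannian metric on U, i.e. a smooth map assigning to each x ∈ U a symmetric positive-definite n×n real matrix g(x). For a piecewise C¹ curve γ : [0,1] → U let L_g(γ) = ∫₀¹ √(⟨g(γ(t)) γ'(t), γ'(t)⟩) dt, and for x,y ∈ U let d_g(x,y) be the infimum of L_g(γ) over piecewise C¹ curves γ in U joining x to y; let μ_g = √(det g) · L^n be the Riemannian volume measure on U, where L^n is Lebesgue measure. Assume that d_g is (1+1/C)-bi-Lipschitz to the background Euclidean metric, i.e. (1+1/C)^{-1}·‖x−y‖ ≤ d_g(x,y) ≤ (1+1/C)·‖x−y‖ for all x,y ∈ U. Let A ⊆ U be a Borel set and let r > 0 be such that the closed d_g-neighborhood of A of radius 2r is compact and contained in U. Then ∫_A (1 − μ_g(B_g(x,r))/(ω_n·rⁿ))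 dμ_g(x) ≤ C·r·∫_{B_g(A,2r)} |g'(y)| dL^n(y), where B_g(x,r) denotes the open d_g-ball of radius r around x, B_g(A,2r) = ⋃_{x∈A} B_g(x,2r), and |g'|(y) = Σ_{i,j,k} |∂g_{ij}/∂x_k (y)|. -/
open MeasureTheory Metric Set

/-- `ω_n`: the Lebesgue volume of the unit ball in `ℝⁿ` (with the Euclidean metric). -/
noncomputable def omegaBall (n : ℕ) : ENNReal :=
  volume (ball (0 : EuclideanSpace ℝ (Fin n)) 1)

/-- The quadratic form `⟨M v, v⟩ = ∑_{i,j} M_{ij} v_i v_j` of a matrix `M` on `ℝⁿ`. -/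
noncomputable def quadForm {n : ℕ} (M : Matrix (Fin n) (Fin n) ℝ)
    (v : EuclideanSpace ℝ (Fin n)) : ℝ :=
  ∑ i, ∑ j, M i j * v i * v j

/-- A curve `γ : [0,1] → ℝⁿ` is piecewise `C¹` if it is continuous on `[0,1]` and there is a
partition `0 = t₀ < t₁ < ⋯ < t_k = 1` such that `γ` is `C¹` on each subinterval. -/
def IsPiecewiseC1 {n : ℕ} (γ : ℝ → EuclideanSpace ℝ (Fin n)) : Prop :=
  ContinuousOn γ (Icc 0 1) ∧
    ∃ (k : ℕ) (t : ℕ → ℝ), 0 < k ∧ t 0 = 0 ∧ t k = 1 ∧ (∀ i < k, t i < t (i + 1)) ∧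
      ∀ i < k, ContDiffOn ℝ 1 γ (Icc (t i) (t (i + 1)))

/-- The Riemannian length `L_g(γ) = ∫₀¹ √(⟨g(γ(t)) γ'(t), γ'(t)⟩) dt` of a curve `γ`
with respect to the metric tensor `g`. -/
noncomputable def gLength {n : ℕ} (g : EuclideanSpace ℝ (Fin n) → Matrix (Fin n) (Fin n) ℝ)
    (γ : ℝ → EuclideanSpace ℝ (Fin n)) : ℝ :=
  ∫ t in (0 : ℝ)..1, Real.sqrt (quadForm (g (γ t)) (deriv γ t))

/-- The Riemannian distance `d_g(x,y)`: the infimum of `L_g(γ)` over piecewise `C¹` curves `γ`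
in `U` joining `x` to `y`. -/
noncomputable def gDist {n : ℕ} (g : EuclideanSpace ℝ (Fin n) → Matrix (Fin n) (Fin n) ℝ)
    (U : Set (EuclideanSpace ℝ (Fin n))) (x y : EuclideanSpace ℝ (Fin n)) : ℝ :=
  sInf {L : ℝ | ∃ γ : ℝ → EuclideanSpace ℝ (Fin n), IsPiecewiseC1 γ ∧ γ 0 = x ∧ γ 1 = y ∧
    (∀ t ∈ Icc (0 : ℝ) 1, γ t ∈ U) ∧ L = gLength g γ}

/-- The open `d_g`-ball `B_g(x,r)` of radius `r` around `x` (inside `U`). -/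
def gBall {n : ℕ} (g : EuclideanSpace ℝ (Fin n) → Matrix (Fin n) (Fin n) ℝ)
    (U : Set (EuclideanSpace ℝ (Fin n))) (x : EuclideanSpace ℝ (Fin n)) (r : ℝ) :
    Set (EuclideanSpace ℝ (Fin n)) :=
  {y ∈ U | gDist g U x y < r}

/-- The Riemannian volume measure `μ_g = √(det g) · Lⁿ` on `ℝⁿ`. -/
noncomputable def gVol {n : ℕ} (g : EuclideanSpace ℝ (Fin n) → Matrix (Fin n) (Fin n) ℝ) :
    Measure (EuclideanSpace ℝ (Fin n)) :=
  volume.withDensity fun x => ENNReal.ofReal (Real.sqrt (g x).det)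

/-- `|g'|(y) = ∑_{i,j,k} |∂ g_{ij} / ∂ x_k (y)|`, the total first derivative of the metric
tensor. -/
noncomputable def gDerivTotal {n : ℕ}
    (g : EuclideanSpace ℝ (Fin n) → Matrix (Fin n) (Fin n) ℝ)
    (y : EuclideanSpace ℝ (Fin n)) : ℝ :=
  ∑ i, ∑ j, ∑ k, |fderiv ℝ (fun x => g x i j) y (EuclideanSpace.single k (1 : ℝ))|

theorem quadForm_eq_inner {n : ℕ} (M : Matrix (Fin n) (Fin n) ℝ) (v : EuclideanSpace ℝ (Fin n)) :
    quadForm M v = v.ofLp ⬝ᵥ M.mulVec v.ofLp := by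
  simp only [quadForm, dotProduct, Matrix.mulVec, Finset.mul_sum]
  exact Finset.sum_congr rfl fun i _ => Finset.sum_congr rfl fun j _ => by ring

theorem quadForm_smul {n : ℕ} (M : Matrix (Fin n) (Fin n) ℝ) (c : ℝ)
    (v : EuclideanSpace ℝ (Fin n)) : quadForm M (c • v) = c ^ 2 * quadForm M v := by
  simp only [quadForm, Finset.mul_sum, PiLp.smul_apply, smul_eq_mul]
  exact Finset.sum_congr rfl fun i _ => Finset.sum_congr rfl fun j _ => by ring

theorem abs_coord_le_norm {n : ℕ} (v : EuclideanSpace ℝ (Fin n)) (i : Fin n) : |v i| ≤ ‖v‖ := by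
  simpa using PiLp.norm_apply_le v i

/-- Two quadratic forms differ by at most the entrywise distance of their matrices. -/
theorem abs_quadForm_sub_le {n : ℕ} (M M' : Matrix (Fin n) (Fin n) ℝ)
    (v : EuclideanSpace ℝ (Fin n)) :
    |quadForm M v - quadForm M' v| ≤ (∑ i, ∑ j, |M i j - M' i j|) * ‖v‖ ^ 2 := by
  have : quadForm M v - quadForm M' v = ∑ i, ∑ j, (M i j - M' i j) * (v i * v j) := by
    simp only [quadForm, ← Finset.sum_sub_distrib]
    exact Finset.sum_congr rfl fun i _ => Finset.sum_congr rfl fun j _ => by ring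
  rw [this, Finset.sum_mul]
  refine (Finset.abs_sum_le_sum_abs _ _).trans (Finset.sum_le_sum fun i _ => ?_)
  rw [Finset.sum_mul]
  refine (Finset.abs_sum_le_sum_abs _ _).trans (Finset.sum_le_sum fun j _ => ?_)
  rw [abs_mul, abs_mul, sq]
  gcongr <;> exact abs_coord_le_norm v _

/-- A positive definite form is the squared norm of the image under a linear map. -/
theorem exists_linearMap_of_posDef {n : ℕ} {M : Matrix (Fin n) (Fin n) ℝ} (hM : M.PosDef) :
    ∃ B : EuclideanSpace ℝ (Fin n) →L[ℝ] EuclideanSpace ℝ (Fin n),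
      (∀ v, quadForm M v = ‖B v‖ ^ 2) ∧ Real.sqrt M.det = |B.det| ∧ 0 < M.det := by
  classical
  open scoped MatrixOrder Matrix.Norms.L2Operator in
  obtain ⟨P, hP⟩ := CStarAlgebra.nonneg_iff_eq_star_mul_self.mp hM.posSemidef.nonneg
  have hP' : M = P.transpose * P := by
    rw [hP, Matrix.star_eq_conjTranspose, Matrix.conjTranspose_eq_transpose_of_trivial]
  refine ⟨Matrix.toEuclideanCLM (𝕜 := ℝ) P, fun v => ?_, ?_, hM.det_pos⟩
  · rw [quadForm_eq_inner, EuclideanSpace.real_norm_sq_eq, hP', ← Matrix.mulVec_mulVec,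
      Matrix.dotProduct_mulVec, Matrix.vecMul_transpose]
    simp [dotProduct, sq]
  · rw [hP', Matrix.det_mul, Matrix.det_transpose, Real.sqrt_mul_self_eq_abs]
    congr 1
    have : (Matrix.toEuclideanCLM (𝕜 := ℝ) P : EuclideanSpace ℝ (Fin n) →ₗ[ℝ] _) =
      Matrix.toLin (EuclideanSpace.basisFun (Fin n) ℝ).toBasis
        (EuclideanSpace.basisFun (Fin n) ℝ).toBasis P := rfl
    rw [ContinuousLinearMap.det, this, LinearMap.det_toLin]

/-- The ellipsoid of a positive definite form, weighted by its volume density, has the volume of a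
Euclidean ball. -/
theorem volume_ellipsoid {n : ℕ} {M : Matrix (Fin n) (Fin n) ℝ} (hM : M.PosDef) {r : ℝ}
    (hr : 0 < r) :
    ENNReal.ofReal (Real.sqrt M.det) *
      volume {v : EuclideanSpace ℝ (Fin n) | Real.sqrt (quadForm M v) < r} =
      omegaBall n * ENNReal.ofReal (r ^ n) := by
  obtain ⟨B, hB, hdet, hpos⟩ := exists_linearMap_of_posDef hM
  have h0 : B.det ≠ 0 := by
    intro h
    rw [h, abs_zero] at hdet
    exact (Real.sqrt_pos.2 hpos).ne' hdet
  have : {v : EuclideanSpace ℝ (Fin n) | Real.sqrt (quadForm M v) < r} = B ⁻¹' ball 0 r := by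
    ext v
    simp [hB, Real.sqrt_sq]
  rw [this, Measure.addHaar_preimage_continuousLinearMap _ h0, hdet, Measure.addHaar_ball_of_pos _ _ hr,
    ← mul_assoc, ← ENNReal.ofReal_mul (abs_nonneg _), abs_inv, mul_inv_cancel₀ (abs_ne_zero.2 h0)]
  simp [omegaBall, mul_comm]

theorem continuousOn_gDerivTotal {n : ℕ} {U : Set (EuclideanSpace ℝ (Fin n))} (hU : IsOpen U)
    {g : EuclideanSpace ℝ (Fin n) → Matrix (Fin n) (Fin n) ℝ}
    (hg : ∀ i j, ContDiffOn ℝ (⊤ : ℕ∞) (fun x => g x i j) U) :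
    ContinuousOn (gDerivTotal g) U := by
  unfold gDerivTotal
  refine continuousOn_finsetSum _ fun i _ => continuousOn_finsetSum _ fun j _ =>
    continuousOn_finsetSum _ fun k _ => ContinuousOn.abs ?_
  have := (hg i j).continuousOn_fderiv_of_isOpen hU (by simp)
  exact this.clm_apply continuousOn_const

theorem gDerivTotal_nonneg {n : ℕ} (g : EuclideanSpace ℝ (Fin n) → Matrix (Fin n) (Fin n) ℝ)
    (y : EuclideanSpace ℝ (Fin n)) : 0 ≤ gDerivTotal g y := by
  unfold gDerivTotal
  positivity

theorem abs_apply_le_sum_single {n : ℕ} (L : EuclideanSpace ℝ (Fin n) →L[ℝ] ℝ)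
    (v : EuclideanSpace ℝ (Fin n)) :
    |L v| ≤ ‖v‖ * ∑ k, |L (EuclideanSpace.single k (1 : ℝ))| := by
  have hv : v = ∑ k, v k • EuclideanSpace.single k (1 : ℝ) := by
    ext i
    simp [Finset.sum_apply, Pi.single_apply]
  calc |L v| = |∑ k, v k * L (EuclideanSpace.single k (1 : ℝ))| := by
        conv_lhs => rw [hv]
        simp
    _ ≤ ∑ k, |v k * L (EuclideanSpace.single k (1 : ℝ))| := Finset.abs_sum_le_sum_abs _ _
    _ ≤ ‖v‖ * ∑ k, |L (EuclideanSpace.single k (1 : ℝ))| := by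
        rw [Finset.mul_sum]
        refine Finset.sum_le_sum fun k _ => ?_
        rw [abs_mul]
        gcongr
        exact abs_coord_le_norm v k

/-- The entrywise variation of `g` along a segment is controlled by the integral of `|g'|`. -/
theorem sum_abs_sub_le_integral {n : ℕ} {U : Set (EuclideanSpace ℝ (Fin n))} (hU : IsOpen U)
    {g : EuclideanSpace ℝ (Fin n) → Matrix (Fin n) (Fin n) ℝ}
    (hg : ∀ i j, ContDiffOn ℝ (⊤ : ℕ∞) (fun x => g x i j) U)
    {x v : EuclideanSpace ℝ (Fin n)} (hseg : ∀ t ∈ Icc (0 : ℝ) 1, x + t • v ∈ U)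
    {t : ℝ} (ht : t ∈ Icc (0 : ℝ) 1) :
    ∑ i, ∑ j, |g (x + t • v) i j - g x i j| ≤
      ‖v‖ * ∫ s in (0 : ℝ)..1, gDerivTotal g (x + s • v) := by
  have hline : ContinuousOn (fun s : ℝ => x + s • v) (Icc 0 1) := by fun_prop
  have hD : ContinuousOn (fun s : ℝ => gDerivTotal g (x + s • v)) (Icc 0 1) :=
    (continuousOn_gDerivTotal hU hg).comp hline hseg
  have hsub : Icc 0 t ⊆ Icc (0 : ℝ) 1 := Icc_subset_Icc_right ht.2
  have hfd : ∀ i j, ContinuousOn (fderiv ℝ (fun x => g x i j)) U := fun i j =>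
    (hg i j).continuousOn_fderiv_of_isOpen hU (by simp)
  have hfdc : ∀ i j, ∀ w : EuclideanSpace ℝ (Fin n), ContinuousOn
      (fun s : ℝ => fderiv ℝ (fun x => g x i j) (x + s • v) w) (Icc 0 t) := fun i j w =>
    (((hfd i j).comp hline hseg).clm_apply continuousOn_const).mono hsub
  have hci : ∀ f : ℝ → ℝ, ContinuousOn f (Icc 0 t) → IntervalIntegrable f volume 0 t :=
    fun f hf => ContinuousOn.intervalIntegrable (by rwa [uIcc_of_le ht.1])
  have hsum : ∀ i j, ContinuousOn (fun s : ℝ => ∑ k : Fin n,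
      |fderiv ℝ (fun x => g x i j) (x + s • v) (EuclideanSpace.single k (1 : ℝ))|) (Icc 0 t) :=
    fun i j => continuousOn_finsetSum _ fun k _ => (hfdc i j _).abs
  have key : ∀ i j, |g (x + t • v) i j - g x i j| ≤ ‖v‖ * ∫ s in (0 : ℝ)..t,
      ∑ k, |fderiv ℝ (fun x => g x i j) (x + s • v) (EuclideanSpace.single k (1 : ℝ))| := by
    intro i j
    have hder : ∀ s ∈ uIcc 0 t, HasDerivAt (fun s : ℝ => g (x + s • v) i j)
        (fderiv ℝ (fun x => g x i j) (x + s • v) v) s := by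
      intro s hs
      rw [uIcc_of_le ht.1] at hs
      have h1 : DifferentiableAt ℝ (fun x => g x i j) (x + s • v) :=
        ((hg i j).differentiableOn (by simp)).differentiableAt (hU.mem_nhds (hseg s (hsub hs)))
      have h2 : HasDerivAt (fun s : ℝ => x + s • v) v s := by
        simpa using ((hasDerivAt_id s).smul_const v).const_add x
      exact h1.hasFDerivAt.comp_hasDerivAt s h2
    have h3 := intervalIntegral.integral_eq_sub_of_hasDerivAt hder (hci _ (hfdc i j v))
    simp only [zero_smul, add_zero] at h3
    rw [← h3, ← intervalIntegral.integral_const_mul]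
    refine (intervalIntegral.abs_integral_le_integral_abs ht.1).trans ?_
    exact intervalIntegral.integral_mono_on ht.1 (hci _ (hfdc i j v).abs)
      (hci _ (continuousOn_const.mul (hsum i j))) fun s _ => abs_apply_le_sum_single _ _
  calc ∑ i, ∑ j, |g (x + t • v) i j - g x i j|
      ≤ ∑ i, ∑ j, ‖v‖ * ∫ s in (0 : ℝ)..t,
        ∑ k, |fderiv ℝ (fun x => g x i j) (x + s • v) (EuclideanSpace.single k (1 : ℝ))| :=
        Finset.sum_le_sum fun i _ => Finset.sum_le_sum fun j _ => key i j
    _ = ‖v‖ * ∫ s in (0 : ℝ)..t, gDerivTotal g (x + s • v) := by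
        unfold gDerivTotal
        simp only [← Finset.mul_sum]
        congr 1
        rw [intervalIntegral.integral_finsetSum fun i _ =>
          hci _ (continuousOn_finsetSum _ fun j _ => hsum i j)]
        refine Finset.sum_congr rfl fun i _ => ?_
        rw [intervalIntegral.integral_finsetSum fun j _ => hci _ (hsum i j)]
    _ ≤ ‖v‖ * ∫ s in (0 : ℝ)..1, gDerivTotal g (x + s • v) := by
        gcongr
        refine intervalIntegral.integral_mono_interval le_rfl ht.1 ht.2 ?_ ?_
        · filter_upwards with s using gDerivTotal_nonneg g _
        · apply ContinuousOn.intervalIntegrable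
          rwa [uIcc_of_le zero_le_one]

theorem gLength_nonneg {n : ℕ} (g : EuclideanSpace ℝ (Fin n) → Matrix (Fin n) (Fin n) ℝ)
    (γ : ℝ → EuclideanSpace ℝ (Fin n)) : 0 ≤ gLength g γ :=
  intervalIntegral.integral_nonneg zero_le_one fun _ _ => Real.sqrt_nonneg _

theorem gDist_le_gLength {n : ℕ} {U : Set (EuclideanSpace ℝ (Fin n))}
    (g : EuclideanSpace ℝ (Fin n) → Matrix (Fin n) (Fin n) ℝ)
    {γ : ℝ → EuclideanSpace ℝ (Fin n)} (hγ : IsPiecewiseC1 γ)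
    (hU : ∀ t ∈ Icc (0 : ℝ) 1, γ t ∈ U) : gDist g U (γ 0) (γ 1) ≤ gLength g γ := by
  refine csInf_le ⟨0, ?_⟩ ⟨γ, hγ, rfl, rfl, hU, rfl⟩
  rintro _ ⟨_, _, _, _, _, rfl⟩
  exact gLength_nonneg _ _

theorem isPiecewiseC1_segment {n : ℕ} (x v : EuclideanSpace ℝ (Fin n)) :
    IsPiecewiseC1 fun t : ℝ => x + t • v := by
  have h : ContDiff ℝ 1 fun t : ℝ => x + t • v := by fun_prop
  refine ⟨h.continuous.continuousOn, 1, fun i => i, one_pos, by simp, by simp, by simp, ?_⟩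
  intro i _
  exact h.contDiffOn

/-- The Riemannian distance is at most the length of a segment. -/
theorem gDist_le_segment {n : ℕ} {U : Set (EuclideanSpace ℝ (Fin n))}
    (g : EuclideanSpace ℝ (Fin n) → Matrix (Fin n) (Fin n) ℝ)
    {x v : EuclideanSpace ℝ (Fin n)} (hseg : ∀ t ∈ Icc (0 : ℝ) 1, x + t • v ∈ U) :
    gDist g U x (x + v) ≤ ∫ t in (0 : ℝ)..1, Real.sqrt (quadForm (g (x + t • v)) v) := by
  have h := gDist_le_gLength g (isPiecewiseC1_segment x v) hseg
  have hd : ∀ t : ℝ, deriv (fun t : ℝ => x + t • v) t = v := fun t => by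
    have h2 : HasDerivAt (fun s : ℝ => x + s • v) v t := by
      simpa using ((hasDerivAt_id t).smul_const v).const_add x
    exact h2.deriv
  simpa [gLength, hd] using h

/-- A pointwise bound for the length element along a segment bounds the distance. -/
theorem gDist_le_of_forall_sqrt_le {n : ℕ} {U : Set (EuclideanSpace ℝ (Fin n))}
    (g : EuclideanSpace ℝ (Fin n) → Matrix (Fin n) (Fin n) ℝ)
    {x v : EuclideanSpace ℝ (Fin n)} (hseg : ∀ t ∈ Icc (0 : ℝ) 1, x + t • v ∈ U) {c : ℝ}
    (hc : ∀ t ∈ Icc (0 : ℝ) 1, Real.sqrt (quadForm (g (x + t • v)) v) ≤ c) :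
    gDist g U x (x + v) ≤ c := by
  refine (gDist_le_segment g hseg).trans ?_
  have := intervalIntegral.norm_integral_le_of_norm_le_const (a := (0 : ℝ)) (b := 1) (C := c)
    (f := fun t => Real.sqrt (quadForm (g (x + t • v)) v)) fun t ht => by
      rw [uIoc_of_le zero_le_one] at ht
      rw [Real.norm_of_nonneg (Real.sqrt_nonneg _)]
      exact hc t ⟨ht.1.le, ht.2⟩
  simpa using (le_abs_self _).trans this

theorem continuousOn_quadForm {n : ℕ} {X : Type*} [TopologicalSpace X] {s : Set X}
    {M : X → Matrix (Fin n) (Fin n) ℝ} {v : X → EuclideanSpace ℝ (Fin n)}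
    (hM : ∀ i j, ContinuousOn (fun x => M x i j) s) (hv : ContinuousOn v s) :
    ContinuousOn (fun x => quadForm (M x) (v x)) s := by
  unfold quadForm
  refine continuousOn_finsetSum _ fun i _ => continuousOn_finsetSum _ fun j _ => ?_
  have h : ∀ i, ContinuousOn (fun x => v x i) s := fun i =>
    (PiLp.continuous_apply 2 (fun _ : Fin n => ℝ) i).comp_continuousOn hv
  exact ((hM i j).mul (h i)).mul (h j)

/-- A lower bound for the Riemannian distance at small scales is a lower bound for the metric
tensor. -/
theorem le_sqrt_quadForm_of_le_gDist {n : ℕ} {U : Set (EuclideanSpace ℝ (Fin n))}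
    (hU : IsOpen U) {g : EuclideanSpace ℝ (Fin n) → Matrix (Fin n) (Fin n) ℝ}
    (hg : ∀ i j, ContinuousOn (fun x => g x i j) U) {c : ℝ}
    {x : EuclideanSpace ℝ (Fin n)} (hx : x ∈ U)
    (hd : ∀ y ∈ U, c * ‖x - y‖ ≤ gDist g U x y) (v : EuclideanSpace ℝ (Fin n)) :
    c * ‖v‖ ≤ Real.sqrt (quadForm (g x) v) := by
  refine le_of_forall_pos_le_add fun ε hε => ?_
  have hline : Continuous fun t : ℝ => x + t • v := by fun_prop
  have hline0 : (fun t : ℝ => x + t • v) 0 = x := by simp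
  have hc : ContinuousAt (fun t : ℝ => Real.sqrt (quadForm (g (x + t • v)) v)) 0 := by
    have h1 : ContinuousAt (fun y => Real.sqrt (quadForm (g y) v)) ((fun t : ℝ => x + t • v) 0) := by
      rw [hline0]
      exact ((continuousOn_quadForm hg continuousOn_const).sqrt).continuousAt (hU.mem_nhds hx)
    exact ContinuousAt.comp (f := fun t : ℝ => x + t • v) h1 hline.continuousAt
  have h1 : ∀ᶠ t in nhds (0 : ℝ), Real.sqrt (quadForm (g (x + t • v)) v) <
      Real.sqrt (quadForm (g x) v) + ε := by
    refine hc.eventually_lt continuousAt_const ?_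
    simpa using hε
  have h2 : ∀ᶠ t in nhds (0 : ℝ), x + t • v ∈ U :=
    hline.continuousAt.eventually (by rw [hline0]; exact hU.mem_nhds hx)
  obtain ⟨δ, hδ, h⟩ := Metric.eventually_nhds_iff.1 (h1.and h2)
  set t : ℝ := δ / 2 with ht
  have htpos : 0 < t := by positivity
  have hsmall : ∀ s ∈ Icc (0 : ℝ) 1, dist (s * t) 0 < δ := fun s hs => by
    rw [Real.dist_eq, sub_zero, abs_of_nonneg (mul_nonneg hs.1 htpos.le)]
    nlinarith [hs.1, hs.2]
  have h3 : gDist g U x (x + t • v) ≤ t * (Real.sqrt (quadForm (g x) v) + ε) := by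
    refine gDist_le_of_forall_sqrt_le g (fun s hs => ?_) fun s hs => ?_
    · rw [smul_smul]
      exact (h (hsmall s hs)).2
    · rw [smul_smul, quadForm_smul, Real.sqrt_mul (sq_nonneg _), Real.sqrt_sq htpos.le]
      exact mul_le_mul_of_nonneg_left (h (hsmall s hs)).1.le htpos.le
  have h4 := hd (x + t • v) (by simpa using (h (hsmall 1 (by simp))).2)
  rw [sub_add_cancel_left, norm_neg, norm_smul, Real.norm_of_nonneg htpos.le] at h4
  have h5 := h4.trans h3
  refine le_of_mul_le_mul_left ?_ htpos
  linarith

theorem sub_le_integral_of_contDiffOn_Icc {n : ℕ} {U : Set (EuclideanSpace ℝ (Fin n))}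
    {g : EuclideanSpace ℝ (Fin n) → Matrix (Fin n) (Fin n) ℝ}
    (hg : ∀ i j, ContinuousOn (fun x => g x i j) U)
    {F : EuclideanSpace ℝ (Fin n) → ℝ}
    {F' : EuclideanSpace ℝ (Fin n) → EuclideanSpace ℝ (Fin n) →L[ℝ] ℝ}
    (hF : ∀ y, HasFDerivAt F (F' y) y) {c : ℝ}
    (hc : ∀ y ∈ U, ∀ w, F' y w ≤ c * Real.sqrt (quadForm (g y) w))
    {γ : ℝ → EuclideanSpace ℝ (Fin n)} {a b : ℝ} (hab : a < b)
    (hγ : ContDiffOn ℝ 1 γ (Icc a b)) (hγU : ∀ t ∈ Icc a b, γ t ∈ U) :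
    IntervalIntegrable (fun t => Real.sqrt (quadForm (g (γ t)) (deriv γ t))) volume a b ∧
    F (γ b) - F (γ a) ≤ c * ∫ t in a..b, Real.sqrt (quadForm (g (γ t)) (deriv γ t)) := by
  have hder : ∀ t ∈ Ioo a b, derivWithin γ (Icc a b) t = deriv γ t := fun t ht =>
    derivWithin_of_mem_nhds (Icc_mem_nhds ht.1 ht.2)
  have hcont : ContinuousOn
      (fun t => Real.sqrt (quadForm (g (γ t)) (derivWithin γ (Icc a b) t))) (Icc a b) := by
    refine (continuousOn_quadForm (fun i j => (hg i j).comp hγ.continuousOn hγU) ?_).sqrt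
    exact hγ.continuousOn_derivWithin (uniqueDiffOn_Icc hab) le_rfl
  have hint : IntervalIntegrable (fun t => Real.sqrt (quadForm (g (γ t)) (deriv γ t)))
      volume a b := by
    rw [intervalIntegrable_iff_integrableOn_Ioo_of_le hab.le]
    refine ((hcont.integrableOn_Icc).mono_set Ioo_subset_Icc_self).congr_fun (fun t ht => ?_)
      measurableSet_Ioo
    simp only [hder t ht]
  refine ⟨hint, ?_⟩
  rw [← intervalIntegral.integral_const_mul]
  refine intervalIntegral.sub_le_integral_of_hasDeriv_right_of_le hab.le (g := fun t => F (γ t))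
    (g' := fun t => F' (γ t) (deriv γ t)) ?_ (fun t ht => ?_) ?_ fun t ht => ?_
  · exact (continuous_iff_continuousAt.2 fun y => (hF y).continuousAt).comp_continuousOn
      hγ.continuousOn
  · have h1 : DifferentiableAt ℝ γ t :=
      (hγ.differentiableOn one_ne_zero).differentiableAt (Icc_mem_nhds ht.1 ht.2)
    exact ((hF _).comp_hasDerivAt t h1.hasDerivAt).hasDerivWithinAt
  · rw [integrableOn_Icc_iff_integrableOn_Ioc]
    exact ((intervalIntegrable_iff_integrableOn_Ioc_of_le hab.le).1 hint).const_mul c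
  · exact hc _ (hγU t (Ioo_subset_Icc_self ht)) _

/-- Calibration: a function whose differential is bounded by the length element bounds the length
of curves from below. -/
theorem sub_le_mul_gLength {n : ℕ} {U : Set (EuclideanSpace ℝ (Fin n))}
    {g : EuclideanSpace ℝ (Fin n) → Matrix (Fin n) (Fin n) ℝ}
    (hg : ∀ i j, ContinuousOn (fun x => g x i j) U)
    {F : EuclideanSpace ℝ (Fin n) → ℝ}
    {F' : EuclideanSpace ℝ (Fin n) → EuclideanSpace ℝ (Fin n) →L[ℝ] ℝ}
    (hF : ∀ y, HasFDerivAt F (F' y) y) {c : ℝ}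
    (hc : ∀ y ∈ U, ∀ w, F' y w ≤ c * Real.sqrt (quadForm (g y) w))
    {γ : ℝ → EuclideanSpace ℝ (Fin n)} (hγ : IsPiecewiseC1 γ)
    (hγU : ∀ t ∈ Icc (0 : ℝ) 1, γ t ∈ U) :
    F (γ 1) - F (γ 0) ≤ c * gLength g γ := by
  obtain ⟨-, k, t, -, ht0, htk, hlt, hC⟩ := hγ
  have hmono : ∀ i j, i ≤ j → j ≤ k → t i ≤ t j := fun i j hij => by
    induction j, hij using Nat.le_induction with
    | base => exact fun _ => le_rfl
    | succ j _ ih => exact fun hj => (ih (by omega)).trans (hlt j (by omega)).le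
  have hpiece := fun i (hi : i < k) => sub_le_integral_of_contDiffOn_Icc hg hF hc (hlt i hi)
    (hC i hi) fun s hs => hγU s
      ⟨ht0 ▸ (hmono 0 i (by omega) hi.le).trans hs.1,
        htk ▸ hs.2.trans (hmono (i + 1) k (by omega) le_rfl)⟩
  have key : ∀ j ≤ k,
      IntervalIntegrable (fun s => Real.sqrt (quadForm (g (γ s)) (deriv γ s))) volume 0 (t j) ∧
      F (γ (t j)) - F (γ 0) ≤
        c * ∫ s in (0 : ℝ)..t j, Real.sqrt (quadForm (g (γ s)) (deriv γ s)) := by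
    intro j
    induction j with
    | zero => simp [ht0]
    | succ j ih =>
      intro hj
      obtain ⟨h1, h2⟩ := ih (by omega)
      obtain ⟨h3, h4⟩ := hpiece j (by omega)
      refine ⟨h1.trans h3, ?_⟩
      rw [← intervalIntegral.integral_add_adjacent_intervals h1 h3, mul_add]
      linarith
  have := (key k le_rfl).2
  rwa [htk] at this

theorem hasDerivAt_max_zero_sq (z : ℝ) :
    HasDerivAt (fun z : ℝ => max z 0 ^ 2) (2 * max z 0) z := by
  rcases lt_trichotomy z 0 with h | rfl | h
  · rw [max_eq_right h.le, mul_zero]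
    refine (hasDerivAt_const z (0 : ℝ)).congr_of_eventuallyEq ?_
    filter_upwards [Iio_mem_nhds h] with y hy
    rw [max_eq_right (le_of_lt hy)]
    simp
  · rw [max_self, mul_zero, hasDerivAt_iff_isLittleO_nhds_zero]
    refine Asymptotics.IsBigO.trans_isLittleO (g := fun h : ℝ => h ^ 2) ?_ ?_
    · refine Asymptotics.IsBigO.of_bound 1 (Filter.Eventually.of_forall fun y => ?_)
      simp only [zero_add, max_self, smul_zero, sub_zero, norm_pow, Real.norm_eq_abs, one_mul]
      have : |max y 0| ≤ |y| := by
        rcases le_total y 0 with h | h <;> simp [h]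
      simpa using pow_le_pow_left₀ (abs_nonneg _) this 2
    · simpa using Asymptotics.isLittleO_pow_pow (𝕜 := ℝ) (one_lt_two)
  · rw [max_eq_left h.le]
    have := hasDerivAt_pow 2 z
    refine (by simpa using this : HasDerivAt (fun z : ℝ => z ^ 2) (2 * z) z).congr_of_eventuallyEq
      ?_
    filter_upwards [Ioi_mem_nhds h] with y hy
    rw [max_eq_left (le_of_lt hy)]

/-- An upper bound for the Riemannian distance at small scales gives an upper bound for the metric
tensor. -/
theorem sqrt_quadForm_le_of_gDist_le {n : ℕ} {U : Set (EuclideanSpace ℝ (Fin n))}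
    (hU : IsOpen U) {g : EuclideanSpace ℝ (Fin n) → Matrix (Fin n) (Fin n) ℝ}
    (hg : ∀ i j, ContinuousOn (fun x => g x i j) U) {c κ : ℝ} (hc0 : 0 < c)
    {x : EuclideanSpace ℝ (Fin n)} (hx : x ∈ U) (hpd : (g x).PosDef)
    (hd : ∀ y ∈ U, c * ‖x - y‖ ≤ gDist g U x y)
    (hd' : ∀ y ∈ U, gDist g U x y ≤ κ * ‖x - y‖) (v : EuclideanSpace ℝ (Fin n)) :
    Real.sqrt (quadForm (g x) v) ≤ 4 * κ * ‖v‖ := by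
  have hlow := le_sqrt_quadForm_of_le_gDist hU hg hx hd
  obtain ⟨B, hB, -, -⟩ := exists_linearMap_of_posDef hpd
  have hBs : ∀ w, Real.sqrt (quadForm (g x) w) = ‖B w‖ := fun w => by
    rw [hB, Real.sqrt_sq (norm_nonneg _)]
  simp only [hBs] at hlow ⊢
  rcases eq_or_ne v 0 with rfl | hv
  · simp
  have hvpos : 0 < ‖v‖ := norm_pos_iff.2 hv
  have hBv : 0 < ‖B v‖ := lt_of_lt_of_le (by positivity) (hlow v)
  obtain ⟨η, hη, hball⟩ : ∃ η > 0, ∀ y, ‖y - x‖ < η → y ∈ U ∧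
      ∀ w, ‖B w‖ ≤ 2 * Real.sqrt (quadForm (g y) w) := by
    have hcont : ContinuousAt (fun y => ∑ i, ∑ j, |g x i j - g y i j|) x := by
      refine ContinuousOn.continuousAt (s := U) ?_ (hU.mem_nhds hx)
      exact continuousOn_finsetSum _ fun i _ => continuousOn_finsetSum _ fun j _ =>
        (continuousOn_const.sub (hg i j)).abs
    have h1 : ∀ᶠ y in nhds x, ∑ i, ∑ j, |g x i j - g y i j| < 3 / 4 * c ^ 2 := by
      refine hcont.eventually_lt continuousAt_const ?_
      simp only [sub_self, abs_zero, Finset.sum_const_zero]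
      positivity
    obtain ⟨η, hη, h⟩ := Metric.eventually_nhds_iff.1 (h1.and (hU.mem_nhds hx))
    refine ⟨η, hη, fun y hy => ?_⟩
    have hy' := h (show dist y x < η by rwa [dist_eq_norm])
    refine ⟨hy'.2, fun w => ?_⟩
    have h2 := (le_abs_self _).trans (abs_quadForm_sub_le (g x) (g y) w)
    have h3 : (∑ i, ∑ j, |g x i j - g y i j|) * ‖w‖ ^ 2 ≤ 3 / 4 * ‖B w‖ ^ 2 := by
      have : (c * ‖w‖) ^ 2 ≤ ‖B w‖ ^ 2 := by
        have := hlow w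
        gcongr
      nlinarith [mul_le_mul_of_nonneg_right hy'.1.le (sq_nonneg ‖w‖)]
    rw [hB] at h2
    have h4 : (‖B w‖ / 2) ^ 2 ≤ quadForm (g y) w := by nlinarith
    linarith [Real.le_sqrt_of_sq_le h4]
  obtain ⟨t, ht, htb, htv⟩ : ∃ t : ℝ, 0 < t ∧ t * ‖B v‖ < c * η ∧ t * ‖v‖ < η := by
    refine ⟨min (c * η / (2 * ‖B v‖)) (η / (2 * ‖v‖)), by positivity, ?_, ?_⟩
    · calc _ ≤ c * η / (2 * ‖B v‖) * ‖B v‖ := by gcongr; exact min_le_left _ _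
        _ = c * η / 2 := by field_simp
        _ < c * η := half_lt_self (by positivity)
    · calc _ ≤ η / (2 * ‖v‖) * ‖v‖ := by gcongr; exact min_le_right _ _
        _ = η / 2 := by field_simp
        _ < η := half_lt_self hη
  set b := t * ‖B v‖ with hb
  have hbpos : 0 < b := by positivity
  set F : EuclideanSpace ℝ (Fin n) → ℝ := fun y => -(max (b ^ 2 - ‖B (y - x)‖ ^ 2) 0 ^ 2) with hFdef
  set F' : EuclideanSpace ℝ (Fin n) → EuclideanSpace ℝ (Fin n) →L[ℝ] ℝ := fun y =>
    (4 * max (b ^ 2 - ‖B (y - x)‖ ^ 2) 0) • ((innerSL ℝ (B (y - x))).comp B) with hF'def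
  have hF : ∀ y, HasFDerivAt F (F' y) y := by
    intro y
    have h1 : HasFDerivAt (fun y => B (y - x)) B y := by
      exact (B.hasFDerivAt (x := y - x)).comp y ((hasFDerivAt_id y).sub_const x)
    have h2 := h1.norm_sq.const_sub (b ^ 2)
    have h3 := ((hasDerivAt_max_zero_sq _).comp_hasFDerivAt y h2).neg
    refine h3.congr_fderiv ?_
    ext w
    simp only [hF'def, neg_apply, smul_apply,
      ContinuousLinearMap.comp_apply, smul_eq_mul, nsmul_eq_mul]
    push_cast
    ring
  have hFc : ∀ y ∈ U, ∀ w, F' y w ≤ (4 * b ^ 3) * Real.sqrt (quadForm (g y) w) := by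
    intro y _ w
    have hval : F' y w = 4 * max (b ^ 2 - ‖B (y - x)‖ ^ 2) 0 * inner ℝ (B (y - x)) (B w) := rfl
    rw [hval]
    rcases le_or_gt b ‖B (y - x)‖ with h | h
    · rw [max_eq_right (by nlinarith)]
      simp only [mul_zero, zero_mul]
      positivity
    · have hyη : ‖y - x‖ < η := by
        have := hlow (y - x)
        nlinarith
      have h1 := (hball y hyη).2 w
      have h2 := real_inner_le_norm (B (y - x)) (B w)
      set N := ‖B (y - x)‖ with hN
      have hN0 : 0 ≤ N := norm_nonneg _
      have hpos : 0 ≤ b ^ 2 - N ^ 2 := by nlinarith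
      rw [max_eq_left hpos]
      have h3 : (b ^ 2 - N ^ 2) * N ≤ b ^ 3 / 2 := by
        nlinarith [mul_nonneg hN0 (sq_nonneg (N - b * (3 / 5))), mul_nonneg hbpos.le
          (sq_nonneg (N - b * (3 / 5))), pow_pos hbpos 3,
          mul_nonneg (sq_nonneg b) (sub_nonneg.2 h.le)]
      calc 4 * (b ^ 2 - N ^ 2) * inner ℝ (B (y - x)) (B w)
          ≤ 4 * (b ^ 2 - N ^ 2) * (N * (2 * Real.sqrt (quadForm (g y) w))) := by
            gcongr
            exact h2.trans (by gcongr)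
        _ = 8 * ((b ^ 2 - N ^ 2) * N) * Real.sqrt (quadForm (g y) w) := by ring
        _ ≤ 8 * (b ^ 3 / 2) * Real.sqrt (quadForm (g y) w) := by gcongr
        _ = (4 * b ^ 3) * Real.sqrt (quadForm (g y) w) := by ring
  have hyU : x + t • v ∈ U := (hball _ (by
    rwa [add_sub_cancel_left, norm_smul, Real.norm_of_nonneg ht.le])).1
  have hnorm : ‖x - (x + t • v)‖ = t * ‖v‖ := by
    rw [sub_add_cancel_left, norm_neg, norm_smul, Real.norm_of_nonneg ht.le]
  have hdlow : b / 4 ≤ gDist g U x (x + t • v) := by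
    refine le_csInf ?_ ?_
    · by_contra hne
      rw [Set.not_nonempty_iff_eq_empty] at hne
      have h1 := hd _ hyU
      rw [hnorm, gDist, hne, Real.sInf_empty] at h1
      have : 0 < c * (t * ‖v‖) := by positivity
      linarith
    · rintro _ ⟨γ, hγ, h0, h1, hγU, rfl⟩
      have h2 := sub_le_mul_gLength hg hF hFc hγ hγU
      have hF1 : F (γ 1) = 0 := by
        simp [hFdef, h1, norm_smul, abs_of_pos ht, hb]
      have hF0 : F (γ 0) = -b ^ 4 := by
        simp only [hFdef, h0, sub_self, map_zero, norm_zero]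
        rw [max_eq_left (by simpa using sq_nonneg b)]
        ring
      rw [hF1, hF0] at h2
      have h3 : b ^ 3 * b ≤ b ^ 3 * (4 * gLength g γ) := by linarith
      linarith [le_of_mul_le_mul_left h3 (pow_pos hbpos 3)]
  have h6 := hdlow.trans (hd' _ hyU)
  rw [hnorm, hb] at h6
  refine le_of_mul_le_mul_left ?_ ht
  linarith

/-- The symmetric matrices whose quadratic form lies between `c ‖v‖²` and `d ‖v‖²`. -/
def ellipticMatrices (n : ℕ) (c d : ℝ) : Set (Fin n → Fin n → ℝ) :=
  {M | (∀ i j, M i j = M j i) ∧ ∀ v : EuclideanSpace ℝ (Fin n),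
    c * ‖v‖ ^ 2 ≤ quadForm (Matrix.of M) v ∧ quadForm (Matrix.of M) v ≤ d * ‖v‖ ^ 2}

theorem abs_entry_le_of_mem_ellipticMatrices {n : ℕ} {c d : ℝ} (hc : 0 ≤ c) (hd : 0 ≤ d)
    {M : Fin n → Fin n → ℝ} (hM : M ∈ ellipticMatrices n c d) (i j : Fin n) :
    |M i j| ≤ 2 * d := by
  classical
  have hq : ∀ v : EuclideanSpace ℝ (Fin n), 0 ≤ quadForm (Matrix.of M) v := fun v =>
    le_trans (by positivity) (hM.2 v).1
  have hdiag : ∀ i, 0 ≤ M i i ∧ M i i ≤ d := fun i => by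
    have h1 := hM.2 (EuclideanSpace.single i (1 : ℝ))
    have h2 : quadForm (Matrix.of M) (EuclideanSpace.single i (1 : ℝ)) = M i i := by
      simp [quadForm]
    rw [h2] at h1
    simp only [PiLp.norm_single, norm_one, one_pow, mul_one] at h1
    exact ⟨hc.trans h1.1, h1.2⟩
  have hpol : ∀ s : ℝ, quadForm (Matrix.of M)
      (EuclideanSpace.single i (1 : ℝ) + EuclideanSpace.single j s) =
      M i i + 2 * s * M i j + s ^ 2 * M j j := fun s => by
    simp only [quadForm, Matrix.of_apply, PiLp.add_apply, PiLp.single_apply, mul_add, add_mul,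
      Finset.sum_add_distrib]
    simp only [mul_ite, mul_zero, ite_mul, zero_mul, Finset.sum_ite_eq',
      Finset.mem_univ, if_true, mul_one, hM.1 j i]
    ring
  have h1 := hq (EuclideanSpace.single i (1 : ℝ) + EuclideanSpace.single j 1)
  have h2 := hq (EuclideanSpace.single i (1 : ℝ) + EuclideanSpace.single j (-1))
  rw [hpol] at h1 h2
  rw [abs_le]
  constructor <;> nlinarith [hdiag i, hdiag j]

theorem isCompact_ellipticMatrices (n : ℕ) {c d : ℝ} (hc : 0 ≤ c) (hd : 0 ≤ d) :
    IsCompact (ellipticMatrices n c d) := by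
  refine Metric.isCompact_of_isClosed_isBounded ?_ ?_
  · have hq : ∀ v : EuclideanSpace ℝ (Fin n),
        Continuous fun M : Fin n → Fin n → ℝ => quadForm (Matrix.of M) v := fun v => by
      simp only [quadForm, Matrix.of_apply]
      fun_prop
    have : ellipticMatrices n c d =
        (⋂ i, ⋂ j, {M : Fin n → Fin n → ℝ | M i j = M j i}) ∩
        ⋂ v : EuclideanSpace ℝ (Fin n), {M | c * ‖v‖ ^ 2 ≤ quadForm (Matrix.of M) v} ∩
          {M | quadForm (Matrix.of M) v ≤ d * ‖v‖ ^ 2} := by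
      ext M
      simp [ellipticMatrices]
    rw [this]
    refine IsClosed.inter (isClosed_iInter fun i => isClosed_iInter fun j => ?_)
      (isClosed_iInter fun v => IsClosed.inter ?_ ?_)
    · exact isClosed_eq (by fun_prop) (by fun_prop)
    · exact isClosed_le continuous_const (hq v)
    · exact isClosed_le (hq v) continuous_const
  · refine isBounded_iff_forall_norm_le.2 ⟨2 * d, fun M hM => ?_⟩
    rw [pi_norm_le_iff_of_nonneg (by positivity)]
    intro i
    rw [pi_norm_le_iff_of_nonneg (by positivity)]
    intro j
    exact abs_entry_le_of_mem_ellipticMatrices hc hd hM i j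

theorem posDef_of_mem_ellipticMatrices {n : ℕ} {c d : ℝ} (hc : 0 < c)
    {M : Fin n → Fin n → ℝ} (hM : M ∈ ellipticMatrices n c d) : (Matrix.of M).PosDef := by
  refine Matrix.PosDef.of_dotProduct_mulVec_pos ?_ fun x hx => ?_
  · ext i j
    simp [hM.1 i j]
  · have h1 := (hM.2 (WithLp.toLp 2 x)).1
    rw [quadForm_eq_inner] at h1
    refine lt_of_lt_of_le ?_ h1
    have : 0 < ‖(WithLp.toLp 2 x : EuclideanSpace ℝ (Fin n))‖ := by
      rw [norm_pos_iff]
      simpa using hx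
    positivity

/-- The volume density is bounded and Lipschitz on uniformly elliptic matrices. -/
theorem exists_sqrt_det_lipschitz (n : ℕ) {c d : ℝ} (hc : 0 < c) (hd : 0 ≤ d) :
    ∃ K > (0 : ℝ), (∀ M ∈ ellipticMatrices n c d, Real.sqrt (Matrix.of M).det ≤ K) ∧
      ∀ M ∈ ellipticMatrices n c d, ∀ M' ∈ ellipticMatrices n c d,
        Real.sqrt (Matrix.of M).det ≤
          Real.sqrt (Matrix.of M').det + K * ∑ i, ∑ j, |M i j - M' i j| := by
  have hcomp := isCompact_ellipticMatrices n hc.le hd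
  set f : (Fin n → Fin n → ℝ) → ℝ := fun M => Real.sqrt (Matrix.of M).det with hf
  have hdet : ContDiff ℝ 1 fun M : Fin n → Fin n → ℝ => (Matrix.of M).det := by
    simp only [Matrix.det_apply, Matrix.of_apply]
    fun_prop
  have hloc : LocallyLipschitzOn (ellipticMatrices n c d) f := by
    intro M hM
    have h1 : ContDiffAt ℝ 1 f M :=
      hdet.contDiffAt.sqrt (posDef_of_mem_ellipticMatrices hc hM).det_pos.ne'
    obtain ⟨K, t, ht, hK⟩ := h1.exists_lipschitzOnWith
    exact ⟨K, t, mem_nhdsWithin_of_mem_nhds ht, hK⟩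
  obtain ⟨L, hL⟩ := hloc.exists_lipschitzOnWith_of_compact hcomp
  obtain ⟨D, hD⟩ := hcomp.bddAbove_image (hdet.continuous.sqrt.continuousOn (s := _))
  refine ⟨max 1 (max D L), by positivity, fun M hM => ?_, fun M hM M' hM' => ?_⟩
  · exact (hD ⟨M, hM, rfl⟩).trans ((le_max_left _ _).trans (le_max_right _ _))
  · have h1 := hL.dist_le_mul M hM M' hM'
    have h2 : dist M M' ≤ ∑ i, ∑ j, |M i j - M' i j| := by
      have hs : ∀ i, 0 ≤ ∑ j, |M i j - M' i j| := fun i => Finset.sum_nonneg fun _ _ => abs_nonneg _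
      rw [dist_pi_le_iff (Finset.sum_nonneg fun i _ => hs i)]
      intro i
      refine le_trans ?_ (Finset.single_le_sum (fun i _ => hs i) (Finset.mem_univ i))
      rw [dist_pi_le_iff (hs i)]
      intro j
      exact Finset.single_le_sum (f := fun j => |M i j - M' i j|) (fun _ _ => abs_nonneg _)
        (Finset.mem_univ j)
    have h3 : (L : ℝ) * dist M M' ≤ max 1 (max D L) * ∑ i, ∑ j, |M i j - M' i j| := by
      gcongr
      exact (le_max_right _ _).trans (le_max_right _ _)
    have h4 : f M - f M' ≤ dist (f M) (f M') := le_abs_self _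
    change f M ≤ f M' + _
    linarith

/-- The integral of `G` along the segment of direction `v` and length `T • v` starting at `x`. -/
noncomputable def rayIntegral {n : ℕ} (G : EuclideanSpace ℝ (Fin n) → ENNReal) (T : ℝ)
    (x v : EuclideanSpace ℝ (Fin n)) : ENNReal :=
  ∫⁻ t in Icc (0 : ℝ) T, G (x + t • v)

theorem measurable_rayIntegral {n : ℕ} {G : EuclideanSpace ℝ (Fin n) → ENNReal}
    (hG : Measurable G) (T : ℝ) :
    Measurable fun p : EuclideanSpace ℝ (Fin n) × EuclideanSpace ℝ (Fin n) =>
      rayIntegral G T p.1 p.2 := by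
  unfold rayIntegral
  refine Measurable.lintegral_prod_right'
    (f := fun q : (EuclideanSpace ℝ (Fin n) × EuclideanSpace ℝ (Fin n)) × ℝ =>
      G (q.1.1 + q.2 • q.1.2)) ?_
  exact hG.comp (by fun_prop)

theorem rayIntegral_mono {n : ℕ} (G : EuclideanSpace ℝ (Fin n) → ENNReal) {T T' : ℝ}
    (h : T ≤ T') (x v : EuclideanSpace ℝ (Fin n)) :
    rayIntegral G T x v ≤ rayIntegral G T' x v :=
  lintegral_mono_set (Icc_subset_Icc_right h)

theorem rayIntegral_smul_le {n : ℕ} (G : EuclideanSpace ℝ (Fin n) → ENNReal)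
    {s T : ℝ} (hs : 1 ≤ s) (hsT : s ≤ T) (x w : EuclideanSpace ℝ (Fin n)) :
    rayIntegral G 1 x (s • w) ≤ rayIntegral G T x w := by
  have hs0 : s ≠ 0 := by linarith
  have hmap := Real.smul_map_volume_mul_left hs0
  set f : ℝ → ENNReal := (Icc (0 : ℝ) T).indicator fun t => G (x + t • w) with hf
  have hemb : MeasurableEmbedding (fun t : ℝ => s * t) :=
    (Homeomorph.mulLeft₀ s hs0).measurableEmbedding
  calc rayIntegral G 1 x (s • w)
      ≤ ∫⁻ t, f (s * t) := by
        unfold rayIntegral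
        rw [← lintegral_indicator measurableSet_Icc]
        refine lintegral_mono fun t => ?_
        by_cases ht : t ∈ Icc (0 : ℝ) 1
        · have : s * t ∈ Icc (0 : ℝ) T := ⟨mul_nonneg (by linarith) ht.1, by nlinarith [ht.1, ht.2]⟩
          simp only [hf, indicator_of_mem ht, indicator_of_mem this, smul_smul, mul_comm t s, le_rfl]
        · simp [indicator_of_notMem ht]
    _ = ∫⁻ t, f t ∂(Measure.map (fun t : ℝ => s * t) volume) := (hemb.lintegral_map _).symm
    _ ≤ ENNReal.ofReal |s| * ∫⁻ t, f t ∂(Measure.map (fun t : ℝ => s * t) volume) := by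
        refine le_mul_of_one_le_left (zero_le) ?_
        rw [ENNReal.one_le_ofReal, abs_of_nonneg (by linarith)]
        exact hs
    _ = ∫⁻ t, f t := by
        rw [← smul_eq_mul, ← lintegral_smul_measure]
        exact congrArg (fun μ => ∫⁻ t, f t ∂μ) hmap
    _ = rayIntegral G T x w := lintegral_indicator measurableSet_Icc _

theorem lintegral_rayIntegral {n : ℕ} {G : EuclideanSpace ℝ (Fin n) → ENNReal}
    (hG : Measurable G) (T : ℝ) (W : Set (EuclideanSpace ℝ (Fin n))) :
    ∫⁻ x, ∫⁻ w in W, rayIntegral G T x w = volume W * ENNReal.ofReal T * ∫⁻ y, G y := by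
  rw [lintegral_lintegral_swap (measurable_rayIntegral hG T).aemeasurable]
  have h : ∀ w, ∫⁻ x, rayIntegral G T x w = ENNReal.ofReal T * ∫⁻ y, G y := by
    intro w
    unfold rayIntegral
    rw [lintegral_lintegral_swap]
    · simp only [lintegral_add_right_eq_self G]
      simp [mul_comm]
    · refine Measurable.aemeasurable ?_
      exact hG.comp (by fun_prop)
  simp only [h, lintegral_const, Measure.restrict_apply_univ]
  ring

/-- The volume of a set is controlled by the average length of its intersection with rays. -/
theorem volume_le_lintegral_volume_ray {n : ℕ} {S : Set (EuclideanSpace ℝ (Fin n))}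
    (hS : MeasurableSet S) :
    volume S ≤ 2 ^ n * ∫⁻ w, volume {s ∈ Icc (1 : ℝ) 2 | s • w ∈ S} := by
  have hm : Measurable fun p : ℝ × EuclideanSpace ℝ (Fin n) =>
      S.indicator (1 : EuclideanSpace ℝ (Fin n) → ENNReal) (p.1 • p.2) :=
    (measurable_one.indicator hS).comp (by fun_prop)
  have h1 : ∫⁻ w, volume {s ∈ Icc (1 : ℝ) 2 | s • w ∈ S} =
      ∫⁻ s in Icc (1 : ℝ) 2, ∫⁻ w, S.indicator (1 : EuclideanSpace ℝ (Fin n) → ENNReal) (s • w) := by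
    rw [lintegral_lintegral_swap hm.aemeasurable]
    refine lintegral_congr fun w => ?_
    have hms : MeasurableSet {s : ℝ | s • w ∈ S} := hS.preimage (by fun_prop)
    have : (fun s : ℝ => S.indicator (1 : EuclideanSpace ℝ (Fin n) → ENNReal) (s • w)) =
        {s : ℝ | s • w ∈ S}.indicator 1 := by
      ext s
      simp [indicator]
    rw [this, lintegral_indicator_one hms, Measure.restrict_apply hms, inter_comm]
    rfl
  rw [h1]
  have h2 : ∀ s ∈ Icc (1 : ℝ) 2, volume S ≤
      2 ^ n * ∫⁻ w, S.indicator (1 : EuclideanSpace ℝ (Fin n) → ENNReal) (s • w) := by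
    intro s hs
    have hs0 : 0 < s := by linarith [hs.1]
    have : (fun w : EuclideanSpace ℝ (Fin n) =>
        S.indicator (1 : EuclideanSpace ℝ (Fin n) → ENNReal) (s • w)) =
        ((fun w => s • w) ⁻¹' S).indicator 1 := rfl
    rw [this, lintegral_indicator_one (hS.preimage (by fun_prop)),
      Measure.addHaar_preimage_smul _ hs0.ne', ← mul_assoc, finrank_euclideanSpace_fin]
    refine le_mul_of_one_le_left (zero_le) ?_
    have h3 : (2 : ENNReal) ^ n = ENNReal.ofReal (2 ^ n) := by
      rw [ENNReal.ofReal_pow zero_le_two]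
      simp
    rw [h3, ← ENNReal.ofReal_mul (by positivity), ENNReal.one_le_ofReal, abs_of_pos (by positivity),
      ← div_eq_mul_inv, one_le_div (by positivity)]
    exact pow_le_pow_left₀ hs0.le hs.2 n
  calc volume S = ∫⁻ _ in Icc (1 : ℝ) 2, volume S := by
        simp only [lintegral_const, Measure.restrict_apply_univ, Real.volume_Icc]
        norm_num
    _ ≤ ∫⁻ s in Icc (1 : ℝ) 2, 2 ^ n * ∫⁻ w, S.indicator (1 : EuclideanSpace ℝ (Fin n) → ENNReal) (s • w) :=
        setLIntegral_mono' measurableSet_Icc h2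
    _ = _ := lintegral_const_mul' _ _ (by simp)

/-- A set in which the homogeneous function `N` is within `a` of its upper bound `r`, with `a`
controlled along rays, has volume controlled by the integral of `a`. -/
theorem volume_le_lintegral_of_ray {n : ℕ} {S : Set (EuclideanSpace ℝ (Fin n))}
    (hS : MeasurableSet S) {N : EuclideanSpace ℝ (Fin n) → ℝ}
    (hN : ∀ s : ℝ, 0 ≤ s → ∀ w, N (s • w) = s * N w) {r r₀ ρ : ℝ} (hr₀ : 0 < r₀)
    (hSN : ∀ v ∈ S, ‖v‖ < ρ ∧ r₀ ≤ N v ∧ N v < r)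
    {a : EuclideanSpace ℝ (Fin n) → ENNReal}
    (ha : ∀ s ∈ Icc (1 : ℝ) 2, ∀ w, s • w ∈ S →
      ENNReal.ofReal r ≤ ENNReal.ofReal (N (s • w)) + a w) :
    volume S ≤ 2 ^ n * ∫⁻ w in ball 0 ρ, ENNReal.ofReal (2 / r₀) * a w := by
  refine (volume_le_lintegral_volume_ray hS).trans (mul_le_mul' le_rfl ?_)
  rw [← lintegral_indicator measurableSet_ball]
  refine lintegral_mono fun w => ?_
  rcases Set.eq_empty_or_nonempty {s ∈ Icc (1 : ℝ) 2 | s • w ∈ S} with he | ⟨s₀, hs₀, hs₀S⟩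
  · rw [he]
    simp
  have hs₀pos : 0 < s₀ := by linarith [hs₀.1]
  obtain ⟨h1, h2, h3⟩ := hSN _ hs₀S
  rw [norm_smul, Real.norm_of_nonneg hs₀pos.le] at h1
  rw [hN _ hs₀pos.le] at h2 h3
  have hw : w ∈ ball (0 : EuclideanSpace ℝ (Fin n)) ρ := by
    rw [mem_ball_zero_iff]
    nlinarith [hs₀.1, norm_nonneg w]
  have hNw : r₀ / 2 ≤ N w := by nlinarith [hs₀.1, hs₀.2]
  have hNpos : 0 < N w := by linarith
  rw [indicator_of_mem hw]
  rcases eq_or_ne (a w) ⊤ with htop | htop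
  · rw [htop, ENNReal.mul_top]
    · exact le_top
    · rw [Ne, ENNReal.ofReal_eq_zero, not_le]
      positivity
  set α := (a w).toReal with hα
  have haα : a w = ENNReal.ofReal α := (ENNReal.ofReal_toReal htop).symm
  have hα0 : 0 ≤ α := ENNReal.toReal_nonneg
  have hsub : {s ∈ Icc (1 : ℝ) 2 | s • w ∈ S} ⊆ Icc ((r - α) / N w) (r / N w) := by
    rintro s ⟨hs, hsS⟩
    have hs0 : 0 ≤ s := by linarith [hs.1]
    have h4 := (hSN _ hsS).2.2
    have h5 := ha s hs w hsS
    rw [hN s hs0] at h4 h5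
    rw [haα, ← ENNReal.ofReal_add (by positivity) hα0,
      ENNReal.ofReal_le_ofReal_iff (by positivity)] at h5
    rw [mem_Icc, div_le_iff₀ hNpos, le_div_iff₀ hNpos]
    exact ⟨by linarith, h4.le⟩
  refine (measure_mono hsub).trans ?_
  rw [Real.volume_Icc, haα, ← ENNReal.ofReal_mul (by positivity)]
  refine ENNReal.ofReal_le_ofReal ?_
  rw [← sub_div, sub_sub_cancel, div_mul_eq_mul_div, div_le_div_iff₀ hNpos hr₀]
  nlinarith

/-- The total derivative of `g` restricted to `W`, as an extended nonnegative function. -/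
noncomputable def gDerivOn {n : ℕ} (g : EuclideanSpace ℝ (Fin n) → Matrix (Fin n) (Fin n) ℝ)
    (W : Set (EuclideanSpace ℝ (Fin n))) : EuclideanSpace ℝ (Fin n) → ENNReal :=
  W.indicator fun y => ENNReal.ofReal (gDerivTotal g y)

theorem measurable_gDerivOn {n : ℕ} {U W : Set (EuclideanSpace ℝ (Fin n))} (hU : IsOpen U)
    {g : EuclideanSpace ℝ (Fin n) → Matrix (Fin n) (Fin n) ℝ}
    (hg : ∀ i j, ContDiffOn ℝ (⊤ : ℕ∞) (fun x => g x i j) U) (hW : MeasurableSet W)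
    (hWU : W ⊆ U) : Measurable (gDerivOn g W) := by
  have h1 : ContinuousOn (fun y => ENNReal.ofReal (gDerivTotal g y)) W :=
    ENNReal.continuous_ofReal.comp_continuousOn ((continuousOn_gDerivTotal hU hg).mono hWU)
  unfold gDerivOn
  classical
  rw [← Set.piecewise_eq_indicator]
  exact h1.measurable_piecewise continuousOn_const hW

theorem ofReal_integral_gDerivTotal_le {n : ℕ} {U W : Set (EuclideanSpace ℝ (Fin n))}
    (hU : IsOpen U) {g : EuclideanSpace ℝ (Fin n) → Matrix (Fin n) (Fin n) ℝ}
    (hg : ∀ i j, ContDiffOn ℝ (⊤ : ℕ∞) (fun x => g x i j) U) (hWU : W ⊆ U)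
    {x v : EuclideanSpace ℝ (Fin n)} (hseg : ∀ t ∈ Icc (0 : ℝ) 1, x + t • v ∈ W) :
    ENNReal.ofReal (∫ s in (0 : ℝ)..1, gDerivTotal g (x + s • v)) ≤
      rayIntegral (gDerivOn g W) 1 x v := by
  have hD : ContinuousOn (fun s : ℝ => gDerivTotal g (x + s • v)) (Icc 0 1) :=
    (continuousOn_gDerivTotal hU hg).comp (by fun_prop) fun t ht => hWU (hseg t ht)
  rw [intervalIntegral.integral_of_le zero_le_one, ← integral_Icc_eq_integral_Ioc,
    ofReal_integral_eq_lintegral_ofReal hD.integrableOn_Icc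
      (Filter.Eventually.of_forall fun s => gDerivTotal_nonneg g _)]
  refine (setLIntegral_congr_fun measurableSet_Icc fun t ht => ?_).le
  rw [gDerivOn, indicator_of_mem (hseg t ht)]

/-- A first-order upper bound for the distance along a segment. -/
theorem gDist_le_sqrt_quadForm_add {n : ℕ} {U : Set (EuclideanSpace ℝ (Fin n))}
    (hU : IsOpen U) {g : EuclideanSpace ℝ (Fin n) → Matrix (Fin n) (Fin n) ℝ}
    (hg : ∀ i j, ContDiffOn ℝ (⊤ : ℕ∞) (fun x => g x i j) U)
    {x v : EuclideanSpace ℝ (Fin n)} (hseg : ∀ t ∈ Icc (0 : ℝ) 1, x + t • v ∈ U)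
    (hlow : 4 / 5 * ‖v‖ ≤ Real.sqrt (quadForm (g x) v)) (hpos : 0 ≤ quadForm (g x) v) :
    gDist g U x (x + v) ≤ Real.sqrt (quadForm (g x) v) +
      ‖v‖ ^ 2 * ∫ s in (0 : ℝ)..1, gDerivTotal g (x + s • v) := by
  set I := ∫ s in (0 : ℝ)..1, gDerivTotal g (x + s • v) with hI
  have hI0 : 0 ≤ I := intervalIntegral.integral_nonneg zero_le_one
    fun s _ => gDerivTotal_nonneg g _
  refine gDist_le_of_forall_sqrt_le g hseg fun t ht => ?_
  refine Real.sqrt_le_iff.2 ⟨by positivity, ?_⟩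
  have h1 := (le_abs_self _).trans (abs_quadForm_sub_le (g (x + t • v)) (g x) v)
  have h2 := sum_abs_sub_le_integral hU hg hseg ht
  have h3 : (∑ i, ∑ j, |g (x + t • v) i j - g x i j|) * ‖v‖ ^ 2 ≤ ‖v‖ * I * ‖v‖ ^ 2 := by
    gcongr
  have h4 := Real.sq_sqrt hpos
  set N := Real.sqrt (quadForm (g x) v)
  have h5 : 4 / 5 * ‖v‖ * (‖v‖ ^ 2 * I) ≤ N * (‖v‖ ^ 2 * I) := by gcongr
  have h6 : 0 ≤ ‖v‖ * (‖v‖ ^ 2 * I) := by positivity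
  nlinarith [sq_nonneg (‖v‖ ^ 2 * I)]

/-- Lower bound for the volume of a small Riemannian ball in terms of the integrals of `|g'|` along
rays. -/
theorem ball_volume_le_gVol_gBall_add {n : ℕ} {U W : Set (EuclideanSpace ℝ (Fin n))}
    (hU : IsOpen U) {g : EuclideanSpace ℝ (Fin n) → Matrix (Fin n) (Fin n) ℝ}
    (hg : ∀ i j, ContDiffOn ℝ (⊤ : ℕ∞) (fun x => g x i j) U)
    (hpd : ∀ x ∈ U, (g x).PosDef)
    (hlow : ∀ x ∈ U, ∀ v, 4 / 5 * ‖v‖ ≤ Real.sqrt (quadForm (g x) v))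
    {K : ℝ} (hK : 0 < K) (hKb : ∀ x ∈ U, Real.sqrt (g x).det ≤ K)
    (hKl : ∀ x ∈ U, ∀ y ∈ U, Real.sqrt (g x).det ≤
      Real.sqrt (g y).det + K * ∑ i, ∑ j, |g x i j - g y i j|)
    (hup : ∀ x ∈ U, ∀ y ∈ U, gDist g U x y ≤ 5 / 4 * ‖x - y‖)
    (hW : MeasurableSet W) (hWU : W ⊆ U) {r : ℝ} (hr : 0 < r)
    {x : EuclideanSpace ℝ (Fin n)} (hx : ball x (5 / 4 * r) ⊆ W) :
    omegaBall n * ENNReal.ofReal (r ^ n) ≤ gVol g (gBall g U x r) +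
      ENNReal.ofReal ((5 / 4 * K + K * (2 ^ n * 40)) * r) *
        ∫⁻ w in ball 0 (5 / 4 * r), rayIntegral (gDerivOn g W) 2 x w := by
  have hxU : x ∈ U := hWU (hx (mem_ball_self (by positivity)))
  set G := gDerivOn g W with hGdef
  have hG : Measurable G := measurable_gDerivOn hU hg hW hWU
  set N : EuclideanSpace ℝ (Fin n) → ℝ := fun v => Real.sqrt (quadForm (g x) v) with hN
  have hNm : Measurable N := by
    have : Continuous fun v : EuclideanSpace ℝ (Fin n) => quadForm (g x) v := by
      unfold quadForm
      fun_prop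
    exact this.sqrt.measurable
  have hquad : ∀ v, 0 ≤ quadForm (g x) v := fun v => by
    obtain ⟨B, hB, -⟩ := exists_linearMap_of_posDef (hpd x hxU)
    rw [hB]
    positivity
  have hNs : ∀ s : ℝ, 0 ≤ s → ∀ w, N (s • w) = s * N w := fun s hs w => by
    simp only [hN, quadForm_smul]
    rw [Real.sqrt_mul (sq_nonneg _), Real.sqrt_sq hs]
  have hNlow : ∀ v, 4 / 5 * ‖v‖ ≤ N v := hlow x hxU
  have hRm : ∀ T, Measurable fun v => rayIntegral G T x v := fun T =>
    (measurable_rayIntegral hG T).comp measurable_prodMk_left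
  set Ell : Set (EuclideanSpace ℝ (Fin n)) := {v | N v < r} with hEll
  set S : Set (EuclideanSpace ℝ (Fin n)) := Ell ∩ ({v | r / 8 ≤ ‖v‖} ∩
    {v | ENNReal.ofReal r ≤
      ENNReal.ofReal (N v) + ENNReal.ofReal (2 * r ^ 2) * rayIntegral G 1 x v}) with hS
  have hEllm : MeasurableSet Ell := measurableSet_lt hNm measurable_const
  have hSm : MeasurableSet S := by
    refine hEllm.inter ((measurableSet_le measurable_const measurable_norm).inter
      (measurableSet_le measurable_const ?_))
    exact hNm.ennreal_ofReal.add ((hRm 1).const_mul _)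
  have hEllnorm : ∀ v ∈ Ell, ‖v‖ < 5 / 4 * r := fun v hv => by
    have h1 := hNlow v
    have h2 : N v < r := hv
    linarith
  have hseg : ∀ v ∈ Ell, ∀ t ∈ Icc (0 : ℝ) 1, x + t • v ∈ W := fun v hv t ht => by
    refine hx ?_
    rw [mem_ball, dist_eq_norm, add_sub_cancel_left, norm_smul, Real.norm_of_nonneg ht.1]
    nlinarith [hEllnorm v hv, ht.1, ht.2, norm_nonneg v]
  have hsegU : ∀ v ∈ Ell, ∀ t ∈ Icc (0 : ℝ) 1, x + t • v ∈ U := fun v hv t ht =>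
    hWU (hseg v hv t ht)
  have hvolS : volume S ≤ 2 ^ n * ∫⁻ w in ball 0 (5 / 4 * r),
      ENNReal.ofReal (2 / (r / 10)) * (ENNReal.ofReal (2 * r ^ 2) * rayIntegral G 2 x w) := by
    refine volume_le_lintegral_of_ray hSm hNs (r := r) (by positivity) (fun v hv => ?_)
      fun s hs w hsw => ?_
    · refine ⟨hEllnorm v hv.1, ?_, hv.1⟩
      have h1 : r / 8 ≤ ‖v‖ := hv.2.1
      linarith [hNlow v]
    · refine (show _ ≤ _ from hsw.2.2).trans ?_
      gcongr
      exact rayIntegral_smul_le G hs.1 hs.2 x w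
  have hT : ∀ v ∈ Ell \ S, x + v ∈ gBall g U x r := by
    rintro v ⟨hv, hvS⟩
    have hxv : x + v ∈ U := by simpa using hsegU v hv 1 (by simp)
    refine ⟨hxv, ?_⟩
    by_cases hsmall : ‖v‖ < r / 8
    · have := hup x hxU _ hxv
      rw [sub_add_cancel_left, norm_neg] at this
      linarith
    · have hlt : ENNReal.ofReal (N v) + ENNReal.ofReal (2 * r ^ 2) * rayIntegral G 1 x v <
          ENNReal.ofReal r := by
        by_contra hcon
        exact hvS ⟨hv, not_lt.1 hsmall, not_lt.1 hcon⟩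
      have h1 := ofReal_integral_gDerivTotal_le hU hg hWU (hseg v hv)
      have h2 := gDist_le_sqrt_quadForm_add hU hg (hsegU v hv) (hNlow v) (hquad v)
      set I := ∫ s in (0 : ℝ)..1, gDerivTotal g (x + s • v) with hI
      have hI0 : 0 ≤ I := intervalIntegral.integral_nonneg zero_le_one
        fun s _ => gDerivTotal_nonneg g _
      have h3 : ENNReal.ofReal (N v + 2 * r ^ 2 * I) < ENNReal.ofReal r := by
        refine lt_of_le_of_lt ?_ hlt
        rw [ENNReal.ofReal_add (Real.sqrt_nonneg _) (by positivity),
          ENNReal.ofReal_mul (by positivity)]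
        gcongr
      rw [ENNReal.ofReal_lt_ofReal_iff hr] at h3
      have h4 : ‖v‖ ^ 2 ≤ 2 * r ^ 2 := by
        nlinarith [hEllnorm v hv, norm_nonneg v]
      have h5 : ‖v‖ ^ 2 * I ≤ 2 * r ^ 2 * I := by gcongr
      exact lt_of_le_of_lt (h2.trans (by gcongr)) h3
  set D := ENNReal.ofReal (Real.sqrt (g x).det) with hD
  have hDK : D ≤ ENNReal.ofReal K := ENNReal.ofReal_le_ofReal (hKb x hxU)
  have hmain : D * volume (Ell \ S) ≤ gVol g (gBall g U x r) +
      ENNReal.ofReal (5 / 4 * K * r) * ∫⁻ w in ball 0 (5 / 4 * r), rayIntegral G 2 x w := by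
    have hTm : MeasurableSet (Ell \ S) := hEllm.diff hSm
    have hemb : MeasurableEmbedding fun v : EuclideanSpace ℝ (Fin n) => x + v :=
      (Homeomorph.addLeft x).measurableEmbedding
    calc D * volume (Ell \ S) = ∫⁻ _ in Ell \ S, D := by simp
      _ ≤ ∫⁻ v in Ell \ S, (ENNReal.ofReal (Real.sqrt (g (x + v)).det) +
          ENNReal.ofReal (5 / 4 * K * r) * rayIntegral G 1 x v) := by
        refine setLIntegral_mono' hTm fun v hv => ?_
        have hxv : x + v ∈ U := by simpa using hsegU v hv.1 1 (by simp)
        have h1 := ofReal_integral_gDerivTotal_le hU hg hWU (hseg v hv.1)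
        have h2 := sum_abs_sub_le_integral hU hg (hsegU v hv.1) (t := 1) (by simp)
        set I := ∫ s in (0 : ℝ)..1, gDerivTotal g (x + s • v) with hI
        have hI0 : 0 ≤ I := intervalIntegral.integral_nonneg zero_le_one
          fun s _ => gDerivTotal_nonneg g _
        have h3 := hKl x hxU _ hxv
        rw [one_smul] at h2
        simp only [abs_sub_comm (g (x + v) _ _)] at h2
        have h4 : K * ∑ i, ∑ j, |g x i j - g (x + v) i j| ≤ 5 / 4 * K * r * I := by
          calc K * ∑ i, ∑ j, |g x i j - g (x + v) i j| ≤ K * (‖v‖ * I) := by gcongr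
            _ ≤ K * (5 / 4 * r * I) := by
              gcongr
              exact (hEllnorm v hv.1).le
            _ = _ := by ring
        calc D ≤ ENNReal.ofReal (Real.sqrt (g (x + v)).det + 5 / 4 * K * r * I) :=
              ENNReal.ofReal_le_ofReal (by linarith)
          _ = ENNReal.ofReal (Real.sqrt (g (x + v)).det) +
              ENNReal.ofReal (5 / 4 * K * r) * ENNReal.ofReal I := by
              rw [ENNReal.ofReal_add (Real.sqrt_nonneg _) (by positivity),
                ENNReal.ofReal_mul (by positivity)]
          _ ≤ _ := by gcongr
      _ = (∫⁻ v in Ell \ S, ENNReal.ofReal (Real.sqrt (g (x + v)).det)) +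
          ENNReal.ofReal (5 / 4 * K * r) * ∫⁻ v in Ell \ S, rayIntegral G 1 x v := by
        rw [lintegral_add_right _ ((hRm 1).const_mul _), lintegral_const_mul _ (hRm 1)]
      _ ≤ _ := by
        refine add_le_add ?_ (mul_le_mul' le_rfl ?_)
        · rw [(measurePreserving_add_left volume x).setLIntegral_comp_emb hemb
            (fun y => ENNReal.ofReal (Real.sqrt (g y).det)) (Ell \ S),
            ← withDensity_apply _ (hemb.measurableSet_image.2 hTm)]
          refine measure_mono ?_
          rintro _ ⟨v, hv, rfl⟩
          exact hT v hv
        · refine (lintegral_mono_set fun v hv => ?_).trans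
            (lintegral_mono fun v => rayIntegral_mono G one_le_two x v)
          simpa using hEllnorm v hv.1
  have hSvol : D * volume S ≤ ENNReal.ofReal (K * (2 ^ n * 40) * r) *
      ∫⁻ w in ball 0 (5 / 4 * r), rayIntegral G 2 x w := by
    refine (mul_le_mul' hDK hvolS).trans (le_of_eq ?_)
    simp only [← mul_assoc]
    rw [lintegral_const_mul _ (hRm 2), ← mul_assoc]
    congr 1
    have h3 : (2 : ENNReal) ^ n = ENNReal.ofReal (2 ^ n) := by
      rw [ENNReal.ofReal_pow zero_le_two]
      simp
    rw [h3, ← ENNReal.ofReal_mul (by positivity), ← ENNReal.ofReal_mul (by positivity),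
      ← ENNReal.ofReal_mul (by positivity)]
    congr 1
    field_simp
    ring
  have hvol : volume Ell = volume (Ell \ S) + volume S := by
    rw [add_comm, ← measure_inter_add_sdiff Ell hSm, inter_eq_self_of_subset_right inter_subset_left]
  rw [← volume_ellipsoid (hpd x hxU) hr]
  change D * volume Ell ≤ _
  rw [hvol, mul_add, add_mul (5 / 4 * K), ENNReal.ofReal_add (by positivity) (by positivity), add_mul,
    ← add_assoc]
  exact add_le_add hmain hSvol

/-- A ball whose trace on an open set stays in a compact subset of it lies in the open set. -/
theorem ball_subset_of_inter_subset_isCompact {E : Type*} [NormedAddCommGroup E]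
    [NormedSpace ℝ E] {U K : Set E} (hU : IsOpen U) (hK : IsCompact K) (hKU : K ⊆ U) {x : E}
    (hx : x ∈ U) {ρ : ℝ} (hρ : 0 < ρ) (h : U ∩ ball x ρ ⊆ K) : ball x ρ ⊆ U :=
  ((convex_ball x ρ).isPreconnected.subset_of_closure_inter_subset (hU.inter isOpen_ball)
    ⟨x, mem_ball_self hρ, hx, mem_ball_self hρ⟩
    fun _ hy => ⟨hKU (closure_minimal h hK.isClosed hy.1), hy.2⟩).trans inter_subset_left

theorem ofReal_one_sub_toReal_div_le {a b e : ENNReal} (ha : a ≠ ⊤) (hb : b ≠ 0) (hb' : b ≠ ⊤)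
    (h : b ≤ a + e) : ENNReal.ofReal (1 - (a / b).toReal) ≤ e / b := by
  rw [ENNReal.ofReal_sub _ ENNReal.toReal_nonneg, ENNReal.ofReal_one,
    ENNReal.ofReal_toReal (ENNReal.div_ne_top ha hb), tsub_le_iff_left, ← ENNReal.add_div,
    ENNReal.le_div_iff_mul_le (.inl hb) (.inl hb'), one_mul]
  exact h

theorem integral_le_toReal_lintegral_ofReal {α : Type*} [MeasurableSpace α] {μ : Measure α}
    (f : α → ℝ) :
    ∫ x, f x ∂μ ≤ (∫⁻ x, ENNReal.ofReal (f x) ∂μ).toReal := by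
  by_cases hf : Integrable f μ
  · rw [integral_eq_lintegral_pos_part_sub_lintegral_neg_part hf]
    exact sub_le_self _ ENNReal.toReal_nonneg
  · rw [integral_undef hf]
    exact ENNReal.toReal_nonneg

theorem gVol_restrict_le {n : ℕ} {g : EuclideanSpace ℝ (Fin n) → Matrix (Fin n) (Fin n) ℝ}
    {A : Set (EuclideanSpace ℝ (Fin n))} (hA : MeasurableSet A) {K : ℝ}
    (hK : ∀ x ∈ A, Real.sqrt (g x).det ≤ K) :
    (gVol g).restrict A ≤ ENNReal.ofReal K • volume.restrict A := by
  refine Measure.le_iff.2 fun s hs => ?_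
  rw [Measure.restrict_apply hs, Measure.smul_apply, Measure.restrict_apply hs, gVol,
    withDensity_apply _ (hs.inter hA), smul_eq_mul, ← setLIntegral_const]
  exact setLIntegral_mono' (hs.inter hA) fun x hx => ENNReal.ofReal_le_ofReal (hK x hx.2)

theorem mem_ellipticMatrices_of_sqrt_le {n : ℕ} {M : Matrix (Fin n) (Fin n) ℝ} (hs : M.IsSymm)
    (hM : M.PosDef) {a b : ℝ} (ha : 0 ≤ a)
    (h : ∀ v, a * ‖v‖ ≤ Real.sqrt (quadForm M v) ∧ Real.sqrt (quadForm M v) ≤ b * ‖v‖) :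
    (fun i j => M i j) ∈ ellipticMatrices n (a ^ 2) (b ^ 2) := by
  obtain ⟨B, hB, -, -⟩ := exists_linearMap_of_posDef hM
  refine ⟨fun i j => hs.apply j i, fun v => ?_⟩
  have h1 : quadForm (Matrix.of fun i j => M i j) v = ‖B v‖ ^ 2 := hB v
  have h2 := h v
  rw [hB v, Real.sqrt_sq (norm_nonneg _)] at h2
  rw [h1, ← mul_pow, ← mul_pow]
  constructor
  · exact pow_le_pow_left₀ (by positivity) h2.1 2
  · exact pow_le_pow_left₀ (norm_nonneg _) h2.2 2

theorem omegaBall_ne_zero (n : ℕ) : omegaBall n ≠ 0 :=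
  (measure_ball_pos volume _ one_pos).ne'

theorem omegaBall_ne_top (n : ℕ) : omegaBall n ≠ ⊤ :=
  measure_ball_lt_top.ne

theorem volume_ball_eq_ofReal_pow_mul_omegaBall {n : ℕ} {ρ : ℝ} (hρ : 0 < ρ) :
    volume (ball (0 : EuclideanSpace ℝ (Fin n)) ρ) =
      ENNReal.ofReal (ρ ^ n) * omegaBall n := by
  rw [Measure.addHaar_ball_of_pos _ _ hρ, finrank_euclideanSpace_fin, omegaBall]

/-- The pointwise bound for the deviation integrand, integrated over `A`. -/
theorem lintegral_deviation_le {n : ℕ} {U W A : Set (EuclideanSpace ℝ (Fin n))}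
    (hU : IsOpen U) {g : EuclideanSpace ℝ (Fin n) → Matrix (Fin n) (Fin n) ℝ}
    (hg : ∀ i j, ContDiffOn ℝ (⊤ : ℕ∞) (fun x => g x i j) U)
    (hpd : ∀ x ∈ U, (g x).PosDef)
    (hlow : ∀ x ∈ U, ∀ v, 4 / 5 * ‖v‖ ≤ Real.sqrt (quadForm (g x) v))
    {K : ℝ} (hK : 0 < K) (hKb : ∀ x ∈ U, Real.sqrt (g x).det ≤ K)
    (hKl : ∀ x ∈ U, ∀ y ∈ U, Real.sqrt (g x).det ≤
      Real.sqrt (g y).det + K * ∑ i, ∑ j, |g x i j - g y i j|)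
    (hup : ∀ x ∈ U, ∀ y ∈ U, gDist g U x y ≤ 5 / 4 * ‖x - y‖)
    (hW : MeasurableSet W) (hWU : W ⊆ U) {r : ℝ} (hr : 0 < r)
    (hA : MeasurableSet A) (hAW : ∀ x ∈ A, ball x (5 / 4 * r) ⊆ W)
    (hfin : ∀ x ∈ A, gVol g (gBall g U x r) ≠ ⊤) :
    ∫⁻ x in A, ENNReal.ofReal
        (1 - (gVol g (gBall g U x r) / (omegaBall n * ENNReal.ofReal (r ^ n))).toReal) ∂(gVol g) ≤
      ENNReal.ofReal (2 * K * (5 / 4 * K + K * (2 ^ n * 40)) * (5 / 4) ^ n * r) *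
        ∫⁻ y in W, ENNReal.ofReal (gDerivTotal g y) := by
  set c := 5 / 4 * K + K * (2 ^ n * 40) with hc
  have hc0 : 0 < c := by positivity
  set b := omegaBall n * ENNReal.ofReal (r ^ n) with hb
  have hrn : 0 < r ^ n := by positivity
  have hb0 : b ≠ 0 := mul_ne_zero (omegaBall_ne_zero n) (by simpa using hrn)
  have hbt : b ≠ ⊤ := ENNReal.mul_ne_top (omegaBall_ne_top n) ENNReal.ofReal_ne_top
  set J : EuclideanSpace ℝ (Fin n) → ENNReal :=
    fun x => ∫⁻ w in ball 0 (5 / 4 * r), rayIntegral (gDerivOn g W) 2 x w with hJ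
  have hAU : A ⊆ U := fun x hx => hWU (hAW x hx (mem_ball_self (by positivity)))
  have hcb : ENNReal.ofReal (c * r) * b⁻¹ ≠ ⊤ :=
    ENNReal.mul_ne_top ENNReal.ofReal_ne_top (ENNReal.inv_ne_top.2 hb0)
  have hpt : ∀ x ∈ A, ENNReal.ofReal (1 - (gVol g (gBall g U x r) / b).toReal) ≤
      ENNReal.ofReal (c * r) * b⁻¹ * J x := fun x hx => by
    refine (ofReal_one_sub_toReal_div_le (hfin x hx) hb0 hbt
      (ball_volume_le_gVol_gBall_add hU hg hpd hlow hK hKb hKl hup hW hWU hr (hAW x hx))).trans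
      (le_of_eq ?_)
    rw [div_eq_mul_inv]
    ring
  have hvol : volume (ball (0 : EuclideanSpace ℝ (Fin n)) (5 / 4 * r)) =
      ENNReal.ofReal ((5 / 4) ^ n) * b := by
    rw [volume_ball_eq_ofReal_pow_mul_omegaBall (by positivity), mul_pow,
      ENNReal.ofReal_mul (by positivity), hb]
    ring
  have hGW : ∫⁻ y, gDerivOn g W y = ∫⁻ y in W, ENNReal.ofReal (gDerivTotal g y) :=
    lintegral_indicator hW _
  calc _ ≤ ∫⁻ x, ENNReal.ofReal (1 - (gVol g (gBall g U x r) / b).toReal)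
          ∂(ENNReal.ofReal K • volume.restrict A) :=
        lintegral_mono' (gVol_restrict_le hA fun x hx => hKb x (hAU hx)) le_rfl
    _ = ENNReal.ofReal K *
        ∫⁻ x in A, ENNReal.ofReal (1 - (gVol g (gBall g U x r) / b).toReal) := by
        rw [lintegral_smul_measure, smul_eq_mul]
    _ ≤ ENNReal.ofReal K * ∫⁻ x, ENNReal.ofReal (c * r) * b⁻¹ * J x := by
        exact mul_le_mul' le_rfl
          ((setLIntegral_mono' hA hpt).trans (setLIntegral_le_lintegral _ _))
    _ = ENNReal.ofReal K * (ENNReal.ofReal (c * r) * b⁻¹ *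
        (ENNReal.ofReal ((5 / 4) ^ n) * b * ENNReal.ofReal 2 *
          ∫⁻ y in W, ENNReal.ofReal (gDerivTotal g y))) := by
        rw [lintegral_const_mul' _ _ hcb, hJ,
          lintegral_rayIntegral (measurable_gDerivOn hU hg hW hWU), hvol, hGW]
    _ = b⁻¹ * b * (ENNReal.ofReal 2 * ENNReal.ofReal K * ENNReal.ofReal (c * r) *
        ENNReal.ofReal ((5 / 4) ^ n)) * ∫⁻ y in W, ENNReal.ofReal (gDerivTotal g y) := by
        ring
    _ = _ := by
        rw [ENNReal.inv_mul_cancel hb0 hbt, one_mul, ← ENNReal.ofReal_mul (by positivity),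
          ← ENNReal.ofReal_mul (by positivity), ← ENNReal.ofReal_mul (by positivity)]
        congr 2
        ring

/-- The conclusion, once the metric is known to be uniformly comparable to the Euclidean one. -/
theorem integral_deviation_le {n : ℕ} {U A : Set (EuclideanSpace ℝ (Fin n))}
    (hU : IsOpen U) {g : EuclideanSpace ℝ (Fin n) → Matrix (Fin n) (Fin n) ℝ}
    (hg : ∀ i j, ContDiffOn ℝ (⊤ : ℕ∞) (fun x => g x i j) U)
    (hpd : ∀ x ∈ U, (g x).PosDef)
    (hlow : ∀ x ∈ U, ∀ v, 4 / 5 * ‖v‖ ≤ Real.sqrt (quadForm (g x) v))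
    {K : ℝ} (hK : 0 < K) (hKb : ∀ x ∈ U, Real.sqrt (g x).det ≤ K)
    (hKl : ∀ x ∈ U, ∀ y ∈ U, Real.sqrt (g x).det ≤
      Real.sqrt (g y).det + K * ∑ i, ∑ j, |g x i j - g y i j|)
    (hup : ∀ x ∈ U, ∀ y ∈ U, gDist g U x y ≤ 5 / 4 * ‖x - y‖)
    (hA : MeasurableSet A) (hAU : A ⊆ U) {r : ℝ} (hr : 0 < r)
    (hcpt : IsCompact {y ∈ U | ∃ x ∈ A, gDist g U x y ≤ 2 * r}) :
    ∫ x in A, (1 - (gVol g (gBall g U x r) / (omegaBall n * ENNReal.ofReal (r ^ n))).toReal)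
        ∂(gVol g) ≤
      2 * K * (5 / 4 * K + K * (2 ^ n * 40)) * (5 / 4) ^ n * r *
        ∫ y in ⋃ x ∈ A, gBall g U x (2 * r), gDerivTotal g y := by
  set Q := {y ∈ U | ∃ x ∈ A, gDist g U x y ≤ 2 * r} with hQ
  have hQU : Q ⊆ U := fun y hy => hy.1
  set V := ⋃ x ∈ A, gBall g U x (2 * r) with hV
  have hVQ : V ⊆ Q := iUnion₂_subset fun x hx y hy => ⟨hy.1, x, hx, le_of_lt hy.2⟩
  have hdist : ∀ x ∈ A, ∀ y ∈ U, y ∈ ball x (5 / 4 * r) → gDist g U x y < 2 * r := by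
    intro x hx y hy hxy
    have h1 := hup x (hAU hx) y hy
    rw [mem_ball', dist_eq_norm] at hxy
    linarith
  have hball : ∀ x ∈ A, ball x (5 / 4 * r) ⊆ U := fun x hx =>
    ball_subset_of_inter_subset_isCompact hU hcpt hQU (hAU hx) (by positivity)
      fun y hy => ⟨hy.1, x, hx, (hdist x hx y hy.1 hy.2).le⟩
  set W := ⋃ x ∈ A, ball x (5 / 4 * r) with hW
  have hWV : W ⊆ V := iUnion₂_mono fun x hx y hy =>
    ⟨hball x hx hy, hdist x hx y (hball x hx hy) hy⟩
  have hWm : MeasurableSet W := (isOpen_biUnion fun _ _ => isOpen_ball).measurableSet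
  have hQvol : gVol g Q ≠ ⊤ := by
    have h1 := gVol_restrict_le hcpt.measurableSet (K := K) fun x hx => hKb x (hQU hx)
    have h2 := h1 Q
    rw [Measure.restrict_apply_self, Measure.smul_apply, Measure.restrict_apply_self,
      smul_eq_mul] at h2
    exact ne_top_of_le_ne_top
      (ENNReal.mul_ne_top ENNReal.ofReal_ne_top hcpt.measure_lt_top.ne) h2
  have hfin : ∀ x ∈ A, gVol g (gBall g U x r) ≠ ⊤ := fun x hx =>
    ne_top_of_le_ne_top hQvol <| measure_mono fun y hy =>
      ⟨hy.1, x, hx, by have := hy.2; linarith⟩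
  have hint : IntegrableOn (gDerivTotal g) V :=
    (((continuousOn_gDerivTotal hU hg).mono hQU).integrableOn_compact hcpt).mono_set hVQ
  have hVint : ∫⁻ y in V, ENNReal.ofReal (gDerivTotal g y) =
      ENNReal.ofReal (∫ y in V, gDerivTotal g y) :=
    (ofReal_integral_eq_lintegral_ofReal hint
      (Filter.Eventually.of_forall fun y => gDerivTotal_nonneg g y)).symm
  have hmain := (lintegral_deviation_le hU hg hpd hlow hK hKb hKl hup hWm
    (hWV.trans (hVQ.trans hQU)) hr hA (fun x hx => subset_iUnion₂_of_subset x hx subset_rfl) hfin).trans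
    (mul_le_mul' le_rfl (lintegral_mono_set hWV))
  rw [hVint, ← ENNReal.ofReal_mul (by positivity)] at hmain
  refine (integral_le_toReal_lintegral_ofReal _).trans ?_
  refine ENNReal.toReal_le_of_le_ofReal (mul_nonneg (by positivity) ?_) hmain
  exact integral_nonneg fun y => gDerivTotal_nonneg g y

/-- For every `n ≥ 1` there is a constant `C > 1` depending only on `n` with
the following property.  Let `U ⊆ ℝⁿ` be open and `g` a smooth Riemannian metric on `U`
(symmetric positive-definite at each point of `U`) whose induced distance `d_g` is
`(1+1/C)`-bi-Lipschitz to the Euclidean one.  Let `A ⊆ U` be Borel and `r > 0` such that the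
closed `d_g`-neighborhood of `A` of radius `2r` is compact and contained in `U`.  Then
`∫_A (1 − μ_g(B_g(x,r))/(ω_n·rⁿ)) dμ_g(x) ≤ C · r · ∫_{B_g(A,2r)} |g'| dLⁿ`. -/
theorem stmt_7 (n : ℕ) (hn : 1 ≤ n) :
    ∃ C > (1 : ℝ), ∀ U : Set (EuclideanSpace ℝ (Fin n)), IsOpen U →
      ∀ g : EuclideanSpace ℝ (Fin n) → Matrix (Fin n) (Fin n) ℝ,
      (∀ i j, ContDiffOn ℝ (⊤ : ℕ∞) (fun x => g x i j) U) →
      (∀ x ∈ U, (g x).IsSymm ∧ (g x).PosDef) →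
      (∀ x ∈ U, ∀ y ∈ U,
        (1 + 1 / C)⁻¹ * ‖x - y‖ ≤ gDist g U x y ∧ gDist g U x y ≤ (1 + 1 / C) * ‖x - y‖) →
      ∀ A : Set (EuclideanSpace ℝ (Fin n)), MeasurableSet A → A ⊆ U →
      ∀ r : ℝ, 0 < r →
      IsCompact {y ∈ U | ∃ x ∈ A, gDist g U x y ≤ 2 * r} →
      {y ∈ U | ∃ x ∈ A, gDist g U x y ≤ 2 * r} ⊆ U →
      ∫ x in A, (1 - (gVol g (gBall g U x r) / (omegaBall n * ENNReal.ofReal (r ^ n))).toReal)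
          ∂(gVol g) ≤
        C * r * ∫ y in ⋃ x ∈ A, gBall g U x (2 * r), gDerivTotal g y := by
  obtain ⟨K, hK, hKb, hKl⟩ :=
    exists_sqrt_det_lipschitz n (c := (4 / 5) ^ 2) (d := 5 ^ 2) (by positivity) (by positivity)
  set c := 2 * K * (5 / 4 * K + K * (2 ^ n * 40)) * (5 / 4) ^ n with hc
  have hc0 : 0 < c := by positivity
  refine ⟨4 + c, by linarith, fun U hU g hg hgp hd A hA hAU r hr hcpt _ => ?_⟩
  have hC : 1 + 1 / (4 + c) ≤ 5 / 4 := by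
    have : 1 / (4 + c) ≤ 1 / 4 := one_div_le_one_div_of_le (by norm_num) (by linarith)
    linarith
  have hC' : 4 / 5 ≤ (1 + 1 / (4 + c))⁻¹ := by
    rw [le_inv_comm₀ (by norm_num) (by positivity)]
    linarith
  have hlow : ∀ x ∈ U, ∀ y ∈ U, 4 / 5 * ‖x - y‖ ≤ gDist g U x y := fun x hx y hy =>
    le_trans (by gcongr) (hd x hx y hy).1
  have hup : ∀ x ∈ U, ∀ y ∈ U, gDist g U x y ≤ 5 / 4 * ‖x - y‖ := fun x hx y hy =>
    (hd x hx y hy).2.trans (by gcongr)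
  have hgc : ∀ i j, ContinuousOn (fun x => g x i j) U := fun i j => (hg i j).continuousOn
  have hsq : ∀ x ∈ U, ∀ v, 4 / 5 * ‖v‖ ≤ Real.sqrt (quadForm (g x) v) := fun x hx =>
    le_sqrt_quadForm_of_le_gDist hU hgc hx (hlow x hx)
  have hell : ∀ x ∈ U, (fun i j => g x i j) ∈ ellipticMatrices n ((4 / 5) ^ 2) (5 ^ 2) :=
    fun x hx => mem_ellipticMatrices_of_sqrt_le (hgp x hx).1 (hgp x hx).2 (by norm_num)
      fun v => ⟨hsq x hx v, (sqrt_quadForm_le_of_gDist_le hU hgc (by norm_num) hx (hgp x hx).2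
        (hlow x hx) (hup x hx) v).trans (by norm_num)⟩
  refine (integral_deviation_le hU hg (fun x hx => (hgp x hx).2) hsq hK
    (fun x hx => hKb _ (hell x hx)) (fun x hx y hy => hKl _ (hell x hx) _ (hell y hy)) hup hA hAU
    hr hcpt).trans ?_
  gcongr
  · exact integral_nonneg fun y => gDerivTotal_nonneg g y
  · linarith
end
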